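/- arXiv:2301.13026 — 3 statements merged into one kernel-verified Lean document; each statement's English description precedes it below -/
import Mathlib

section
/- For p > N, the Morrey-type constant μ_p(B_1) = min{∫_{B_1}|∇u|^p : u ∈ W^{1,p}(B_1), u(0)=1, u(z)=0} (z ∈ ∂B_1 fixed) satisfies lim_{p→∞} μ_p(B_1)^{1/p} = 1. -/
open Set Metric MeasureTheory Filter

/-- `g` is the distributional (weak) gradient of `u` on the open set `Ω`. -/
def IsWeakGradOn {N : ℕ} (Ω : Set (EuclideanSpace ℝ (Fin N)))
    (u : EuclideanSpace ℝ (Fin N) → ℝ)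
    (g : EuclideanSpace ℝ (Fin N) → EuclideanSpace ℝ (Fin N)) : Prop :=
  ∀ φ : EuclideanSpace ℝ (Fin N) → ℝ, ContDiff ℝ (⊤ : ℕ∞) φ → HasCompactSupport φ →
    tsupport φ ⊆ Ω → ∫ x in Ω, u x • gradient φ x = - ∫ x in Ω, φ x • g x

/-- The Morrey-type constant
`μ_p(B_1) = inf {∫_{B_1} |∇u|^p : u ∈ W^{1,p}(B_1), u(0) = 1, u(z) = 0}`,
where pointwise values are taken via the continuous representative. -/
noncomputable def muBall {N : ℕ} (p : ℝ) (z : EuclideanSpace ℝ (Fin N)) : ℝ :=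
  sInf {E : ℝ | ∃ (u : EuclideanSpace ℝ (Fin N) → ℝ)
      (g : EuclideanSpace ℝ (Fin N) → EuclideanSpace ℝ (Fin N)),
    ContinuousOn u (Metric.closedBall (0 : EuclideanSpace ℝ (Fin N)) 1) ∧
    IsWeakGradOn (Metric.ball (0 : EuclideanSpace ℝ (Fin N)) 1) u g ∧
    MeasureTheory.IntegrableOn u (Metric.ball (0 : EuclideanSpace ℝ (Fin N)) 1) ∧
    MeasureTheory.IntegrableOn (fun x => ‖g x‖ ^ p)
      (Metric.ball (0 : EuclideanSpace ℝ (Fin N)) 1) ∧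
    u 0 = 1 ∧ u z = 0 ∧
    E = ∫ x in Metric.ball (0 : EuclideanSpace ℝ (Fin N)) 1, ‖g x‖ ^ p}


abbrev EE (N : ℕ) := EuclideanSpace ℝ (Fin N)

theorem inner_gradient_aux {N : ℕ} (φ : EE N → ℝ) (x v : EE N) :
    inner ℝ v (gradient φ x) = fderiv ℝ φ x v := by
  rw [real_inner_comm, gradient, InnerProductSpace.toDual_symm_apply]

theorem continuous_gradient_aux {N : ℕ} {φ : EE N → ℝ} (hφ : ContDiff ℝ (⊤ : ℕ∞) φ) :
    Continuous (gradient φ) := by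
  have h1 : Continuous (fderiv ℝ φ) := hφ.continuous_fderiv (by simp)
  exact (InnerProductSpace.toDual ℝ (EE N)).symm.continuous.comp h1

theorem intOn_of_cont {N : ℕ} {F : Type*} [NormedAddCommGroup F] {f : EE N → F}
    (hf : Continuous f) : IntegrableOn f (ball (0 : EE N) 1) :=
  (hf.continuousOn.integrableOn_compact (isCompact_closedBall (0 : EE N) 1)).mono_set
    ball_subset_closedBall

theorem weak_dir {N : ℕ} {u : EE N → ℝ} {g : EE N → EE N} (hu : Continuous u)
    (hg : IsWeakGradOn (ball (0 : EE N) 1) u g)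
    {φ : EE N → ℝ} (h1 : ContDiff ℝ (⊤ : ℕ∞) φ) (h2 : HasCompactSupport φ)
    (h3 : tsupport φ ⊆ ball (0 : EE N) 1)
    (hi : IntegrableOn (fun x => φ x • g x) (ball (0 : EE N) 1)) (v : EE N) :
    ∫ x in ball (0 : EE N) 1, u x * fderiv ℝ φ x v =
      - ∫ x in ball (0 : EE N) 1, φ x * inner ℝ v (g x) := by
  have h := congrArg (fun w => inner ℝ v w) (hg φ h1 h2 h3)
  simp only [inner_neg_right] at h
  rw [← integral_inner hi, ← integral_inner] at h
  · simpa only [inner_smul_right, inner_gradient_aux] using h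
  · exact intOn_of_cont (hu.smul (continuous_gradient_aux h1))

theorem weak_div {N : ℕ} {u : EE N → ℝ} {g : EE N → EE N} (hu : Continuous u)
    (hg : IsWeakGradOn (ball (0 : EE N) 1) u g)
    (hi : ∀ φ : EE N → ℝ, ContDiff ℝ (⊤ : ℕ∞) φ → HasCompactSupport φ →
      tsupport φ ⊆ ball (0 : EE N) 1 → IntegrableOn (fun x => φ x • g x) (ball (0 : EE N) 1))
    {κ : EE N → ℝ} (h1 : ContDiff ℝ (⊤ : ℕ∞) κ) (h2 : HasCompactSupport κ)
    (h3 : tsupport κ ⊆ ball (0 : EE N) 1) (a : EE N) :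
    ∫ x in ball (0 : EE N) 1, u x * (N * κ x + fderiv ℝ κ x (x - a)) =
      - ∫ x in ball (0 : EE N) 1, κ x * inner ℝ (x - a) (g x) := by
  let e : Fin N → EE N := fun i => EuclideanSpace.single i (1:ℝ)
  let φ : Fin N → EE N → ℝ := fun i x => κ x * inner ℝ (e i) (x - a)
  have hsum : ∀ y : EE N, ∑ i, (inner ℝ (e i) y) • e i = y := by
    intro y
    have := (EuclideanSpace.basisFun (Fin N) ℝ).sum_repr' y
    simpa [e] using this
  have c1 : ∀ i, ContDiff ℝ (⊤ : ℕ∞) (φ i) := fun i =>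
    h1.mul (contDiff_const.inner ℝ (contDiff_id.sub contDiff_const))
  have c2 : ∀ i, HasCompactSupport (φ i) := fun i => h2.mul_right
  have c3 : ∀ i, tsupport (φ i) ⊆ ball (0 : EE N) 1 := fun i =>
    (tsupport_mul_subset_left).trans h3
  have hd : ∀ i x, fderiv ℝ (φ i) x (e i) =
      κ x + fderiv ℝ κ x (e i) * inner ℝ (e i) (x - a) := by
    intro i x
    have hk : HasFDerivAt κ (fderiv ℝ κ x) x := (h1.differentiable (by simp) x).hasFDerivAt
    have hl : HasFDerivAt (fun x : EE N => inner ℝ (e i) (x - a)) (innerSL ℝ (e i)) x :=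
      (innerSL ℝ (e i)).hasFDerivAt.comp x ((hasFDerivAt_id x).sub_const a)
    rw [show φ i = κ * (fun x : EE N => inner ℝ (e i) (x - a)) from rfl, (hk.mul hl).fderiv]
    simp [e]
    ring
  have key := fun i => weak_dir hu hg (c1 i) (c2 i) (c3 i) (hi _ (c1 i) (c2 i) (c3 i)) (e i)
  have key2 := Finset.sum_congr (rfl : (Finset.univ : Finset (Fin N)) = Finset.univ)
    (fun i _ => key i)
  rw [Finset.sum_neg_distrib, ← integral_finsetSum, ← integral_finsetSum] at key2
  · convert key2 using 1
    · apply integral_congr_ae; filter_upwards with x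
      rw [← Finset.mul_sum]
      congr 1
      simp only [hd, Finset.sum_add_distrib]
      congr 1
      · simp
      · conv_lhs => rw [← hsum (x - a)]
        rw [map_sum]
        refine Finset.sum_congr rfl fun i _ => ?_
        rw [map_smul, smul_eq_mul, mul_comm]
    · congr 1
      apply integral_congr_ae; filter_upwards with x
      simp only [φ, mul_assoc]
      rw [← Finset.mul_sum]
      congr 1
      conv_lhs => rw [← hsum (x - a)]
      rw [sum_inner]
      refine Finset.sum_congr rfl fun i _ => ?_
      rw [real_inner_smul_left]
  · intro i _
    have := (hi _ (c1 i) (c2 i) (c3 i)).const_inner (𝕜 := ℝ) (e i)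
    simpa only [inner_smul_right] using this
  · intro i _
    exact intOn_of_cont (hu.mul (((c1 i).continuous_fderiv (by simp)).clm_apply continuous_const))

theorem change_var {N : ℕ} (f η : EE N → ℝ) (a : EE N) {s : ℝ} (hs : 0 < s) :
    ∫ x, f x * (s ^ N * η (a + s • (x - a))) = ∫ y, f (a + s⁻¹ • (y - a)) * η y := by
  have h0 : ∀ h : EE N → ℝ, ∫ x, s ^ N * h (a + s • (x - a)) = ∫ x, h x := by
    intro h
    rw [integral_const_mul, integral_sub_right_eq_self (fun x => h (a + s • x)) a,
      Measure.integral_comp_smul_of_nonneg volume (fun x => h (a + x)) s (hR := hs.le),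
      integral_add_left_eq_self h a]
    simp
    field_simp
  rw [← h0 (fun y => f (a + s⁻¹ • (y - a)) * η y)]
  apply integral_congr_ae; filter_upwards with x
  simp only [add_sub_cancel_left, smul_smul, inv_mul_cancel₀ hs.ne', one_smul, add_sub_cancel]
  ring

theorem hasDerivAt_H {N : ℕ} {u η : EE N → ℝ} (hu : Continuous u)
    (hη : ContDiff ℝ (⊤ : ℕ∞) η) (a : EE N) (s₀ : ℝ) :
    HasDerivAt (fun s : ℝ => ∫ x in ball (0 : EE N) 1, u x * (s ^ N * η (a + s • (x - a))))
      (∫ x in ball (0 : EE N) 1, u x * (N * s₀ ^ (N - 1) * η (a + s₀ • (x - a)) +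
        s₀ ^ N * fderiv ℝ η (a + s₀ • (x - a)) (x - a))) s₀ := by
  let F' : ℝ → EE N → ℝ := fun s x => u x * (N * s ^ (N - 1) * η (a + s • (x - a)) +
        s ^ N * fderiv ℝ η (a + s • (x - a)) (x - a))
  have hηc := hη.continuous
  have hηd : Continuous (fderiv ℝ η) := hη.continuous_fderiv (by simp)
  have hF'c : Continuous (Function.uncurry F') := by
    have h1 : Continuous (fun q : ℝ × EE N => fderiv ℝ η (a + q.1 • (q.2 - a)) (q.2 - a)) :=
      (hηd.comp (by fun_prop)).clm_apply (by fun_prop)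
    change Continuous (fun q : ℝ × EE N => u q.2 * (N * q.1 ^ (N - 1) * η (a + q.1 • (q.2 - a)) +
        q.1 ^ N * fderiv ℝ η (a + q.1 • (q.2 - a)) (q.2 - a)))
    fun_prop
  obtain ⟨C, hC⟩ := ((isCompact_closedBall s₀ 1).prod
    (isCompact_closedBall (0 : EE N) 1)).exists_bound_of_continuousOn hF'c.continuousOn
  refine (hasDerivAt_integral_of_dominated_loc_of_deriv_le (F' := F') (bound := fun _ => C)
    (closedBall_mem_nhds s₀ one_pos) ?_ ?_ ?_ ?_ ?_ ?_).2
  · filter_upwards with s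
    exact (Continuous.aestronglyMeasurable (by fun_prop))
  · exact intOn_of_cont (by fun_prop)
  · exact (hF'c.comp (Continuous.prodMk_right s₀)).aestronglyMeasurable
  · refine (ae_restrict_iff' measurableSet_ball).2 (Eventually.of_forall fun x hx s hs => ?_)
    exact hC (s, x) ⟨hs, ball_subset_closedBall hx⟩
  · exact intOn_of_cont continuous_const
  · filter_upwards with x s _
    have h1 : HasDerivAt (fun s : ℝ => a + s • (x - a)) (x - a) s := by
      simpa using ((hasDerivAt_id s).smul_const (x - a)).const_add a
    have h2 : HasDerivAt (fun s : ℝ => η (a + s • (x - a)))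
        (fderiv ℝ η (a + s • (x - a)) (x - a)) s :=
      (hη.differentiable (by simp) _).hasFDerivAt.comp_hasDerivAt s h1
    exact ((hasDerivAt_pow N s).mul h2).const_mul (u x)

theorem kappa_contDiff {N : ℕ} {η : EE N → ℝ} (hη : ContDiff ℝ (⊤ : ℕ∞) η) (a : EE N) (s : ℝ) :
    ContDiff ℝ (⊤ : ℕ∞) (fun x : EE N => s ^ N * η (a + s • (x - a))) := by
  have : ContDiff ℝ (⊤ : ℕ∞) (fun x : EE N => a + s • (x - a)) := by fun_prop
  exact contDiff_const.mul (hη.comp this)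

theorem kappa_mem {N : ℕ} {a x : EE N} (ha : a ∈ closedBall (0 : EE N) 1) {s : ℝ} (hs : 1 ≤ s)
    (hx : a + s • (x - a) ∈ ball (0 : EE N) 1) : x ∈ ball (0 : EE N) 1 := by
  have hs0 : 0 < s := by linarith
  have h := (convex_ball (0 : EE N) 1).combo_closure_interior_mem_interior
    (x := a) (y := a + s • (x - a)) (a := 1 - s⁻¹) (b := s⁻¹)
    (by rw [closure_ball _ one_ne_zero]; exact ha) (by rwa [isOpen_ball.interior_eq])
    (by have := inv_le_one_of_one_le₀ hs; linarith) (by positivity) (by ring)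
  rw [isOpen_ball.interior_eq] at h
  convert h using 1
  rw [smul_add, smul_smul, inv_mul_cancel₀ hs0.ne']
  module

theorem kappa_tsupport {N : ℕ} {η : EE N → ℝ} 
    (hs : tsupport η ⊆ ball (0 : EE N) 1) {a : EE N} (ha : a ∈ closedBall (0 : EE N) 1)
    {s : ℝ} (h1 : 1 ≤ s) :
    tsupport (fun x : EE N => s ^ N * η (a + s • (x - a))) ⊆ ball (0 : EE N) 1 := by
  have hcl : IsClosed ((fun x : EE N => a + s • (x - a)) ⁻¹' tsupport η) :=
    (isClosed_tsupport η).preimage (by fun_prop)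
  have : tsupport (fun x : EE N => s ^ N * η (a + s • (x - a))) ⊆
      ((fun x : EE N => a + s • (x - a)) ⁻¹' tsupport η) := by
    refine closure_minimal ?_ hcl
    intro x hx
    apply subset_tsupport
    simp only [Function.mem_support] at hx ⊢
    exact right_ne_zero_of_mul hx
  exact this.trans fun x hx => kappa_mem ha h1 (hs hx)

theorem compact_of_tsupport {N : ℕ} {η : EE N → ℝ} 
    (hs : tsupport η ⊆ ball (0 : EE N) 1) : HasCompactSupport η :=
  (isCompact_closedBall (0 : EE N) 1).of_isClosed_subset (isClosed_tsupport _)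
    (hs.trans ball_subset_closedBall)

theorem setInt_eq {N : ℕ} {f κ : EE N → ℝ} (hs : tsupport κ ⊆ ball (0 : EE N) 1) :
    ∫ x in ball (0 : EE N) 1, f x * κ x = ∫ x, f x * κ x := by
  apply setIntegral_eq_integral_of_forall_compl_eq_zero
  intro x hx
  rw [image_eq_zero_of_notMem_tsupport (fun h => hx (hs h)), mul_zero]

theorem young_aux {p lam r : ℝ} (hp : 1 < p) (hl : 0 < lam) (hr : 0 ≤ r) :
    r ≤ lam * (1 - 1 / p) + lam ^ (1 - p) / p * r ^ p := by
  have h := one_add_mul_self_le_rpow_one_add (s := r / lam - 1)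
    (by have : 0 ≤ r / lam := by positivity
        linarith) hp.le
  rw [show 1 + (r / lam - 1) = r / lam by ring, Real.div_rpow hr hl.le] at h
  rw [Real.rpow_sub hl, Real.rpow_one]
  have hlp : 0 < lam ^ p := Real.rpow_pos_of_pos hl p
  have hp0 : 0 < p := by linarith
  have h2 : (lam / p) * (1 + p * (r / lam - 1)) ≤ (lam / p) * (r ^ p / lam ^ p) :=
    mul_le_mul_of_nonneg_left h (by positivity)
  have e1 : (lam / p) * (1 + p * (r / lam - 1)) = r - lam * (1 - 1 / p) := by
    field_simp; ring
  have e2 : lam / lam ^ p / p * r ^ p = (lam / p) * (r ^ p / lam ^ p) := by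
    field_simp
  rw [e2]; linarith

/-- weighted mean bound -/
theorem mean_bound {N : ℕ} {g : EE N → EE N} {κ : EE N → ℝ} {p lam C : ℝ} (hp : 1 < p)
    (hl : 0 < lam) (hκc : Continuous κ) (hκ0 : ∀ x, 0 ≤ κ x) (hκC : ∀ x, κ x ≤ C)
    (hκ1 : ∫ x in ball (0 : EE N) 1, κ x = 1)
    (hi : IntegrableOn (fun x => κ x • g x) (ball (0 : EE N) 1))
    (hgp : IntegrableOn (fun x => ‖g x‖ ^ p) (ball (0 : EE N) 1))
    (hC : C * ∫ x in ball (0 : EE N) 1, ‖g x‖ ^ p ≤ lam ^ p) :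
    ∫ x in ball (0 : EE N) 1, κ x * ‖g x‖ ≤ lam := by
  have hp0 : 0 < p := by linarith
  have hi' : IntegrableOn (fun x => κ x * ‖g x‖) (ball (0 : EE N) 1) := by
    have := hi.norm
    simp only [norm_smul, Real.norm_eq_abs, abs_of_nonneg (hκ0 _)] at this
    exact this
  have hkp : IntegrableOn (fun x => κ x * ‖g x‖ ^ p) (ball (0 : EE N) 1) := by
    refine hgp.bdd_mul (c := C) hκc.aestronglyMeasurable (Eventually.of_forall fun x => ?_)
    rw [Real.norm_eq_abs, abs_of_nonneg (hκ0 x)]; exact hκC x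
  have hkp2 : ∫ x in ball (0 : EE N) 1, κ x * ‖g x‖ ^ p ≤ lam ^ p := by
    refine le_trans ?_ hC
    rw [← integral_const_mul]
    refine integral_mono hkp (hgp.const_mul C) fun x => ?_
    exact mul_le_mul_of_nonneg_right (hκC x) (by positivity)
  have hκi : IntegrableOn κ (ball (0 : EE N) 1) := intOn_of_cont hκc
  calc ∫ x in ball (0 : EE N) 1, κ x * ‖g x‖
      ≤ ∫ x in ball (0 : EE N) 1, (lam * (1 - 1 / p) * κ x + lam ^ (1 - p) / p * (κ x * ‖g x‖ ^ p)) := by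
        refine integral_mono hi' ((hκi.const_mul _).add (hkp.const_mul _)) fun x => ?_
        have := mul_le_mul_of_nonneg_left (young_aux hp hl (norm_nonneg (g x))) (hκ0 x)
        calc _ ≤ _ := this
          _ = _ := by ring
    _ = lam * (1 - 1 / p) + lam ^ (1 - p) / p * ∫ x in ball (0 : EE N) 1, κ x * ‖g x‖ ^ p := by
        rw [integral_add (hκi.const_mul _) (hkp.const_mul _), integral_const_mul,
          integral_const_mul, hκ1, mul_one]
    _ ≤ lam * (1 - 1 / p) + lam ^ (1 - p) / p * lam ^ p := by gcongr
    _ = lam := by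
        rw [Real.rpow_sub hl, Real.rpow_one]
        have : lam ^ p ≠ 0 := (Real.rpow_pos_of_pos hl p).ne'
        field_simp
        ring

theorem half_bound {N : ℕ} {u : EE N → ℝ} {g : EE N → EE N} (hu : Continuous u)
    (hg : IsWeakGradOn (ball (0 : EE N) 1) u g)
    (hi : ∀ φ : EE N → ℝ, ContDiff ℝ (⊤ : ℕ∞) φ → HasCompactSupport φ →
      tsupport φ ⊆ ball (0 : EE N) 1 → IntegrableOn (fun x => φ x • g x) (ball (0 : EE N) 1))
    {p : ℝ} (hp : 1 < p) (hpN : N < p)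
    (hgp : IntegrableOn (fun x => ‖g x‖ ^ p) (ball (0 : EE N) 1))
    {a : EE N} (ha : a ∈ closedBall (0 : EE N) 1)
    {η : EE N → ℝ} (hη : ContDiff ℝ (⊤ : ℕ∞) η) (hηs : tsupport η ⊆ ball (0 : EE N) 1)
    (hη0 : ∀ x, 0 ≤ η x) {M : ℝ} (hηM : ∀ x, η x ≤ M) (hη1 : ∫ x, η x = 1)
    {R : ℝ} (hR0 : 0 ≤ R) (hR : ∀ x, η x ≠ 0 → ‖x - a‖ ≤ R) {L : ℝ} (hL : 0 < L)
    (hLE : M * ∫ x in ball (0 : EE N) 1, ‖g x‖ ^ p ≤ L ^ p) :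
    |(∫ x, u x * η x) - u a| ≤ R * L / (1 - N / p) := by
  have hηc := hη.continuous
  have hp0 : 0 < p := by linarith
  let σ : ℝ := N / p
  have hσ : 0 < 1 - σ := by
    have : σ < 1 := (div_lt_one hp0).2 hpN
    linarith
  let F : ℝ → ℝ := fun t => ∫ y in closedBall (0 : EE N) 1, u (a + t • (y - a)) * η y
  have hFall : ∀ t, F t = ∫ y, u (a + t • (y - a)) * η y := by
    intro t
    apply setIntegral_eq_integral_of_forall_compl_eq_zero
    intro x hx
    rw [image_eq_zero_of_notMem_tsupport (fun h => hx (ball_subset_closedBall (hηs h))), mul_zero]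
  have hFc : Continuous F := by
    apply continuous_parametric_integral_of_continuous (f := fun (t : ℝ) (y : EE N) =>
      u (a + t • (y - a)) * η y) _ (isCompact_closedBall (0 : EE N) 1)
    change Continuous (fun q : ℝ × EE N => u (a + q.1 • (q.2 - a)) * η q.2)
    fun_prop
  have hF0 : F 0 = u a := by
    rw [hFall]; simp [integral_const_mul, hη1]
  have hF1 : F 1 = ∫ x, u x * η x := by
    rw [hFall]; simp
  let κ : ℝ → EE N → ℝ := fun s x => s ^ N * η (a + s • (x - a))
  have kts : ∀ s, 1 ≤ s → tsupport (κ s) ⊆ ball (0 : EE N) 1 := fun s hs =>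
    kappa_tsupport hηs ha hs
  have hFH : ∀ t ∈ Ioo (0:ℝ) 1, F t = ∫ x in ball (0 : EE N) 1, u x * κ t⁻¹ x := by
    intro t ht
    rw [hFall, setInt_eq (kts t⁻¹ ((one_le_inv₀ ht.1).2 ht.2.le))]
    have := change_var u η a (inv_pos.2 ht.1)
    rw [inv_inv] at this
    exact this.symm
  have hder : ∀ t ∈ Ioo (0:ℝ) 1, HasDerivAt F
      (t⁻¹ * ∫ x in ball (0 : EE N) 1, κ t⁻¹ x * inner ℝ (x - a) (g x)) t := by
    intro t ht
    have hs1 : 1 ≤ t⁻¹ := (one_le_inv₀ ht.1).2 ht.2.le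
    have h1 := (hasDerivAt_H hu hη a t⁻¹).comp t (hasDerivAt_inv ht.1.ne')
    have h2 := weak_div hu hg hi (kappa_contDiff hη a t⁻¹) (compact_of_tsupport (kts t⁻¹ hs1))
      (kts t⁻¹ hs1) a
    have h3 : ∀ x : EE N, u x * (N * κ t⁻¹ x + fderiv ℝ (κ t⁻¹) x (x - a)) =
        t⁻¹ * (u x * (N * t⁻¹ ^ (N - 1) * η (a + t⁻¹ • (x - a)) +
        t⁻¹ ^ N * fderiv ℝ η (a + t⁻¹ • (x - a)) (x - a))) := by
      intro x
      have d1 : HasFDerivAt (fun x : EE N => a + t⁻¹ • (x - a))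
          (t⁻¹ • ContinuousLinearMap.id ℝ (EE N)) x :=
        (((hasFDerivAt_id x).sub_const a).const_smul t⁻¹).const_add a
      have d2 : HasFDerivAt (κ t⁻¹) (t⁻¹ ^ N • ((fderiv ℝ η (a + t⁻¹ • (x - a))).comp
          (t⁻¹ • ContinuousLinearMap.id ℝ (EE N)))) x :=
        ((hη.differentiable (by simp) _).hasFDerivAt.comp x d1).const_mul _
      rw [d2.fderiv]
      simp only [κ, _root_.smul_apply, ContinuousLinearMap.comp_apply,
        ContinuousLinearMap.id_apply, map_smul, smul_eq_mul]
      have : (N : ℝ) * t⁻¹ ^ N = t⁻¹ * (N * t⁻¹ ^ (N - 1)) := by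
        rcases Nat.eq_zero_or_pos N with h | h
        · simp [h]
        · conv_lhs => rw [← Nat.sub_add_cancel h, pow_succ]
          rw [Nat.sub_add_cancel h]; ring
      linear_combination (u x * η (a + t⁻¹ • (x - a))) * this
    have h4 : (∫ x in ball (0 : EE N) 1, u x * (N * κ t⁻¹ x + fderiv ℝ (κ t⁻¹) x (x - a))) =
        - ∫ x in ball (0 : EE N) 1, κ t⁻¹ x * inner ℝ (x - a) (g x) := h2
    simp_rw [h3] at h4
    rw [integral_const_mul] at h4
    have h5 := h1.congr_of_eventuallyEq (f₁ := F) (by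
      filter_upwards [Ioo_mem_nhds ht.1 ht.2] with r hr
      exact hFH r hr)
    refine h5.congr_deriv ?_
    have ht0 := ht.1.ne'
    rw [← neg_eq_iff_eq_neg] at h4
    rw [← h4]
    field_simp
  have hbd : ∀ t ∈ Ioo (0:ℝ) 1,
      |t⁻¹ * ∫ x in ball (0 : EE N) 1, κ t⁻¹ x * inner ℝ (x - a) (g x)| ≤ R * L * t ^ (-σ) := by
    intro t ht
    have ht0 := ht.1
    have hs1 : 1 ≤ t⁻¹ := (one_le_inv₀ ht.1).2 ht.2.le
    have hκd := kappa_contDiff hη a t⁻¹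
    have hκ0 : ∀ x, 0 ≤ κ t⁻¹ x := fun x => mul_nonneg (by positivity) (hη0 _)
    have hint := hi _ hκd (compact_of_tsupport (kts t⁻¹ hs1)) (kts t⁻¹ hs1)
    have hi' : IntegrableOn (fun x => κ t⁻¹ x * ‖g x‖) (ball (0 : EE N) 1) := by
      have := hint.norm
      simp only [norm_smul, Real.norm_eq_abs] at this
      refine this.congr (Eventually.of_forall fun x => ?_)
      change |κ t⁻¹ x| * _ = _
      rw [abs_of_nonneg (hκ0 x)]
    have hm : ∫ x in ball (0 : EE N) 1, κ t⁻¹ x * ‖g x‖ ≤ L * t ^ (-σ) := by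
      refine mean_bound (C := t⁻¹ ^ N * M) hp (by positivity) hκd.continuous hκ0 (fun x => ?_) ?_
        hint hgp ?_
      · exact mul_le_mul_of_nonneg_left (hηM _) (by positivity)
      · have e1 := setInt_eq (f := fun _ => 1) (kts t⁻¹ hs1)
        have e2 := change_var (fun _ => 1) η a (inv_pos.2 ht0)
        simp only [one_mul] at e1 e2
        exact e1.trans (e2.trans hη1)
      · rw [Real.mul_rpow hL.le (by positivity), ← Real.rpow_mul ht0.le,
          show -σ * p = -(N : ℝ) by simp only [σ]; field_simp, Real.rpow_neg ht0.le,
          Real.rpow_natCast, mul_assoc, inv_pow, mul_comm (L ^ p)]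
        gcongr
    rw [abs_mul, abs_of_pos (inv_pos.2 ht0)]
    calc t⁻¹ * |∫ x in ball (0 : EE N) 1, κ t⁻¹ x * inner ℝ (x - a) (g x)|
        ≤ t⁻¹ * ∫ x in ball (0 : EE N) 1, (t * R) * (κ t⁻¹ x * ‖g x‖) := by
          gcongr
          rw [← Real.norm_eq_abs]
          refine norm_integral_le_of_norm_le (hi'.const_mul (t * R)) (Eventually.of_forall fun x => ?_)
          rw [norm_mul, Real.norm_eq_abs, abs_of_nonneg (hκ0 x)]
          by_cases h : η (a + t⁻¹ • (x - a)) = 0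
          · simp [κ, h]
          · have h6 := hR _ h
            rw [add_sub_cancel_left, norm_smul, Real.norm_eq_abs, abs_of_pos (inv_pos.2 ht0),
              inv_mul_le_iff₀ ht0] at h6
            calc κ t⁻¹ x * ‖inner ℝ (x - a) (g x)‖ ≤ κ t⁻¹ x * ((t * R) * ‖g x‖) := by
                  refine mul_le_mul_of_nonneg_left ?_ (hκ0 x)
                  exact (norm_inner_le_norm _ _).trans (by gcongr)
              _ = _ := by ring
      _ = R * ∫ x in ball (0 : EE N) 1, κ t⁻¹ x * ‖g x‖ := by
          rw [integral_const_mul]; field_simp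
      _ ≤ R * (L * t ^ (-σ)) := by gcongr
      _ = _ := by ring
  let G : ℝ → ℝ := fun t => R * L / (1 - σ) * t ^ (1 - σ)
  have hGc : Continuous G := continuous_const.mul (Real.continuous_rpow_const hσ.le)
  have hGd : ∀ t ∈ Ioo (0:ℝ) 1, HasDerivAt G (R * L * t ^ (-σ)) t := by
    intro t ht
    have := (Real.hasDerivAt_rpow_const (p := 1 - σ) (Or.inl ht.1.ne')).const_mul (R * L / (1 - σ))
    refine this.congr_deriv ?_
    rw [show 1 - σ - 1 = -σ by ring]
    field_simp
  have hG0 : G 0 = 0 := by simp [G, Real.zero_rpow hσ.ne']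
  have hG1 : G 1 = R * L / (1 - σ) := by simp [G]
  have m1 : MonotoneOn (fun t => G t - F t) (Icc 0 1) := by
    apply monotoneOn_of_deriv_nonneg (convex_Icc 0 1) (hGc.sub hFc).continuousOn
    · rw [interior_Icc]
      exact fun t ht => ((hGd t ht).sub (hder t ht)).differentiableAt.differentiableWithinAt
    · rw [interior_Icc]
      intro t ht
      rw [((hGd t ht).sub (hder t ht)).deriv]
      have := (abs_le.1 (hbd t ht)).2
      linarith
  have m2 : MonotoneOn (fun t => G t + F t) (Icc 0 1) := by
    apply monotoneOn_of_deriv_nonneg (convex_Icc 0 1) (hGc.add hFc).continuousOn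
    · rw [interior_Icc]
      exact fun t ht => ((hGd t ht).add (hder t ht)).differentiableAt.differentiableWithinAt
    · rw [interior_Icc]
      intro t ht
      rw [((hGd t ht).add (hder t ht)).deriv]
      have := (abs_le.1 (hbd t ht)).1
      linarith
  have n1 := m1 (left_mem_Icc.2 zero_le_one) (right_mem_Icc.2 zero_le_one) zero_le_one
  have n2 := m2 (left_mem_Icc.2 zero_le_one) (right_mem_Icc.2 zero_le_one) zero_le_one
  simp only [hG0, hG1, hF0, hF1] at n1 n2
  change _ ≤ R * L / (1 - σ)
  rw [abs_le]
  constructor <;> linarith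

theorem good_g {N : ℕ} {u : EE N → ℝ} {g : EE N → EE N} (hu : Continuous u)
    (hg : IsWeakGradOn (ball (0 : EE N) 1) u g) {p : ℝ} (hp : 1 < p)
    (hgp : IntegrableOn (fun x => ‖g x‖ ^ p) (ball (0 : EE N) 1)) :
    ∃ g' : EE N → EE N, IsWeakGradOn (ball (0 : EE N) 1) u g' ∧
    (∀ φ : EE N → ℝ, ContDiff ℝ (⊤ : ℕ∞) φ → HasCompactSupport φ →
      tsupport φ ⊆ ball (0 : EE N) 1 → IntegrableOn (fun x => φ x • g' x) (ball (0 : EE N) 1)) ∧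
    IntegrableOn (fun x => ‖g' x‖ ^ p) (ball (0 : EE N) 1) ∧
    ∫ x in ball (0 : EE N) 1, ‖g' x‖ ^ p ≤ ∫ x in ball (0 : EE N) 1, ‖g x‖ ^ p := by
  have hp0 : p ≠ 0 := by linarith
  by_cases h : ∀ φ : EE N → ℝ, ContDiff ℝ (⊤ : ℕ∞) φ → HasCompactSupport φ →
      tsupport φ ⊆ ball (0 : EE N) 1 → IntegrableOn (fun x => φ x • g x) (ball (0 : EE N) 1)
  · exact ⟨g, hg, h, hgp, le_rfl⟩
  push Not at h
  obtain ⟨ψ, a1, a2, a3, a4⟩ := h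
  refine ⟨fun _ => 0, ?_, ?_, ?_, ?_⟩
  · intro φ b1 b2 b3
    simp only [smul_zero, integral_zero, neg_zero]
    by_cases hφ : IntegrableOn (fun x => φ x • g x) (ball (0 : EE N) 1)
    · have hn : ¬ IntegrableOn (fun x => (φ + ψ) x • g x) (ball (0 : EE N) 1) := by
        intro h
        apply a4
        have := h.sub hφ
        refine this.congr (Eventually.of_forall fun x => ?_)
        simp [add_smul]
      have c3 : tsupport (φ + ψ) ⊆ ball (0 : EE N) 1 :=
        (tsupport_add φ ψ).trans (union_subset b3 a3)
      have e1 := hg (φ + ψ) (b1.add a1) (b2.add a2) c3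
      have e2 := hg ψ a1 a2 a3
      rw [integral_undef hn, neg_zero] at e1
      rw [integral_undef a4, neg_zero] at e2
      have e3 : ∀ x, u x • gradient (φ + ψ) x = u x • gradient φ x + u x • gradient ψ x := by
        intro x
        rw [← smul_add]
        congr 1
        simp only [gradient]
        rw [fderiv_add (b1.differentiable (by simp) x) (a1.differentiable (by simp) x), map_add]
      simp_rw [e3] at e1
      have j1 : IntegrableOn (fun x => u x • gradient φ x) (ball (0 : EE N) 1) :=
        intOn_of_cont (hu.smul (continuous_gradient_aux b1))
      have j2 : IntegrableOn (fun x => u x • gradient ψ x) (ball (0 : EE N) 1) :=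
        intOn_of_cont (hu.smul (continuous_gradient_aux a1))
      rw [integral_add j1 j2, e2, add_zero] at e1
      exact e1
    · rw [hg φ b1 b2 b3, integral_undef hφ, neg_zero]
  · intro φ _ _ _
    simp
  · simp [Real.zero_rpow hp0]
  · simp only [norm_zero, Real.zero_rpow hp0, integral_zero]
    exact integral_nonneg fun x => by positivity

theorem extend_u {N : ℕ} {u : EE N → ℝ} (hu : ContinuousOn u (closedBall (0 : EE N) 1)) :
    ∃ v : EE N → ℝ, Continuous v ∧ ∀ x ∈ closedBall (0 : EE N) 1, v x = u x := by
  obtain ⟨v, hv⟩ := ContinuousMap.exists_restrict_eq (isClosed_closedBall (x := (0 : EE N)) (ε := 1))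
    ⟨(closedBall (0 : EE N) 1).domRestrict u, hu.domRestrict⟩
  refine ⟨v, v.continuous, fun x hx => ?_⟩
  exact congrArg (fun f => f ⟨x, hx⟩) hv

theorem weak_congr {N : ℕ} {u v : EE N → ℝ} {g : EE N → EE N}
    (hg : IsWeakGradOn (ball (0 : EE N) 1) u g)
    (h : ∀ x ∈ closedBall (0 : EE N) 1, v x = u x) : IsWeakGradOn (ball (0 : EE N) 1) v g := by
  intro φ b1 b2 b3
  rw [← hg φ b1 b2 b3]
  refine setIntegral_congr_fun measurableSet_ball fun x hx => ?_
  simp only [h x (ball_subset_closedBall hx)]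

theorem exists_eta {N : ℕ} {c : EE N} (hc : ‖c‖ = 1 / 2) {ρ : ℝ} (h0 : 0 < ρ) (h1 : ρ < 1 / 2) :
    ∃ η : EE N → ℝ, ContDiff ℝ (⊤ : ℕ∞) η ∧ (∀ x, 0 ≤ η x) ∧ ∫ x, η x = 1 ∧
      tsupport η ⊆ ball (0 : EE N) 1 ∧ ∀ x, η x ≠ 0 → ‖x - c‖ ≤ ρ := by
  let f : ContDiffBump c := ⟨ρ / 2, ρ, by positivity, by linarith⟩
  let η : EE N → ℝ := f.normed volume
  have hη : ContDiff ℝ (⊤ : ℕ∞) η := f.contDiff_normed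
  have hη0 : ∀ x, 0 ≤ η x := f.nonneg_normed
  have hη1 : ∫ x, η x = 1 := f.integral_normed
  have hηs : tsupport η ⊆ ball (0 : EE N) 1 := by
    rw [show tsupport η = closedBall c ρ from f.tsupport_normed_eq]
    intro x hx
    rw [mem_closedBall, dist_eq_norm] at hx
    rw [mem_ball_zero_iff]
    have := norm_add_le (x - c) c
    rw [sub_add_cancel] at this
    linarith
  have hηn : ∀ x, η x ≠ 0 → ‖x - c‖ ≤ ρ := by
    intro x hx
    have : x ∈ Function.support η := hx
    rw [show Function.support η = ball c ρ from f.support_normed_eq, mem_ball, dist_eq_norm] at this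
    exact this.le
  exact ⟨η, hη, hη0, hη1, hηs, hηn⟩

set_option maxHeartbeats 1000000 in
theorem core_lower {N : ℕ} {z : EE N} (hz : ‖z‖ = 1) {ρ : ℝ} (h0 : 0 < ρ) (h1 : ρ < 1 / 2) :
    ∃ M : ℝ, 0 < M ∧ ∀ p : ℝ, 1 < p → N < p → ∀ (u : EE N → ℝ) (g : EE N → EE N),
      ContinuousOn u (closedBall (0 : EE N) 1) → IsWeakGradOn (ball (0 : EE N) 1) u g →
      IntegrableOn (fun x => ‖g x‖ ^ p) (ball (0 : EE N) 1) → u 0 = 1 → u z = 0 →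
      ((1 - N / p) / (1 + 2 * ρ)) ^ p / M ≤ ∫ x in ball (0 : EE N) 1, ‖g x‖ ^ p := by
  obtain ⟨c, hcz, hc⟩ : ∃ c : EE N, c + c = z ∧ ‖c‖ = 1 / 2 :=
    ⟨(1 / 2 : ℝ) • z, by module, by simp [norm_smul, hz]⟩
  obtain ⟨η, hη, hη0, hη1, hηs, hηn⟩ := exists_eta hc h0 h1
  obtain ⟨M0, hM0⟩ := (compact_of_tsupport hηs).exists_bound_of_continuous hη.continuous
  have hM : ∀ x, η x ≤ max M0 1 := fun x =>
    (le_abs_self _).trans ((hM0 x).trans (le_max_left _ _))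
  refine ⟨max M0 1, lt_of_lt_of_le one_pos (le_max_right _ _), ?_⟩
  generalize max M0 1 = M at hM
  intro p hp hpN u₀ g₀ hu₀ hg₀ hgp₀ hu00 hu0z
  have hMpos : 0 < M := by
    by_contra hneg
    push Not at hneg
    have : ∫ x, η x ≤ 0 := integral_nonpos fun x => (hM x).trans hneg
    linarith
  obtain ⟨u, hu, huv⟩ := extend_u hu₀
  obtain ⟨g, hg, hi, hgp, hle⟩ := good_g hu (weak_congr hg₀ huv) hp hgp₀
  refine le_trans ?_ hle
  have z1 : (0 : EE N) ∈ closedBall (0 : EE N) 1 := by simp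
  have z2 : z ∈ closedBall (0 : EE N) 1 := by simp [hz]
  have u0 : u 0 = 1 := (huv 0 z1).trans hu00
  have uz : u z = 0 := (huv z z2).trans hu0z
  have hp0 : 0 < p := by linarith
  have hσ : 0 < 1 - N / p := by
    have : N / p < 1 := (div_lt_one hp0).2 hpN
    linarith
  set I := ∫ x in ball (0 : EE N) 1, ‖g x‖ ^ p with hI
  have hI0 : 0 ≤ I := integral_nonneg fun x => by positivity
  have key : ∀ L : ℝ, 0 < L → M * I ≤ L ^ p → (1 - N / p) / (1 + 2 * ρ) ≤ L := by
    intro L hL hLE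
    have b1 := half_bound hu hg hi hp hpN hgp z1 hη hηs hη0 hM hη1 (R := 1 / 2 + ρ)
      (by linarith) (fun x hx => by
        have := norm_add_le (x - c) c
        rw [sub_add_cancel] at this
        have := hηn x hx
        rw [sub_zero]; linarith) hL hLE
    have b2 := half_bound hu hg hi hp hpN hgp z2 hη hηs hη0 hM hη1 (R := 1 / 2 + ρ)
      (by linarith) (fun x hx => by
        have h3 := norm_sub_le (x - c) c
        have h4 : x - c - c = x - z := by rw [sub_sub, hcz]
        rw [h4] at h3
        have := hηn x hx
        linarith) hL hLE
    rw [u0] at b1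
    rw [uz] at b2
    have b3 : 1 ≤ 2 * ((1 / 2 + ρ) * L / (1 - N / p)) := by
      have := (abs_le.1 b1).1
      have := (abs_le.1 b2).2
      linarith
    rw [div_le_iff₀ (by linarith)]
    have : 2 * ((1 / 2 + ρ) * L / (1 - N / p)) = L * (1 + 2 * ρ) / (1 - N / p) := by ring
    rw [this, le_div_iff₀ hσ] at b3
    linarith
  set A := (1 - N / p) / (1 + 2 * ρ) with hA
  have hA0 : 0 < A := div_pos hσ (by linarith)
  rw [div_le_iff₀ hMpos]
  by_contra hlt
  push Not at hlt
  have hMI : 0 ≤ M * I := mul_nonneg hMpos.le hI0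
  clear_value I A
  have h5 : (M * I) ^ (1 / p) < A := by
    have h6 := Real.rpow_lt_rpow (z := 1 / p) hMI (by linarith : M * I < A ^ p) (by positivity)
    rwa [← Real.rpow_mul hA0.le, mul_one_div_cancel hp0.ne', Real.rpow_one] at h6
  have h7 := key (max (A / 2) ((M * I) ^ (1 / p))) (lt_max_of_lt_left (by linarith)) (by
    calc M * I = ((M * I) ^ (1 / p)) ^ p := by
          rw [← Real.rpow_mul hMI, one_div_mul_cancel hp0.ne', Real.rpow_one]
      _ ≤ _ := Real.rpow_le_rpow (by positivity) (le_max_right _ _) hp0.le)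
  have : max (A / 2) ((M * I) ^ (1 / p)) < A := max_lt (by linarith) h5
  linarith

theorem linear_weak {N : ℕ} (z : EE N) :
    IsWeakGradOn (ball (0 : EE N) 1) (fun x => 1 - inner ℝ z x) (fun _ => -z) := by
  intro φ b1 b2 b3
  have hu : Continuous (fun x : EE N => 1 - inner ℝ z x) := by fun_prop
  have hφ := b1.continuous
  have i1 : IntegrableOn (fun x => (1 - inner ℝ z x) • gradient φ x) (ball (0 : EE N) 1) :=
    intOn_of_cont (hu.smul (continuous_gradient_aux b1))
  have i2 : IntegrableOn (fun x => φ x • -z) (ball (0 : EE N) 1) :=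
    intOn_of_cont (by fun_prop)
  refine ext_inner_left ℝ fun v => ?_
  rw [inner_neg_right, ← integral_inner i1, ← integral_inner i2]
  simp only [inner_smul_right, inner_gradient_aux]
  have hdc : Continuous (fun x => fderiv ℝ φ x v) :=
    (b1.continuous_fderiv (by simp)).clm_apply continuous_const
  have hds : HasCompactSupport (fun x => fderiv ℝ φ x v) := b2.fderiv_apply ℝ v
  have t1 : tsupport (fun x => fderiv ℝ φ x v) ⊆ ball (0 : EE N) 1 :=
    (tsupport_fderiv_apply_subset ℝ v).trans b3
  have hd : ∀ x, HasFDerivAt (fun x : EE N => 1 - inner ℝ z x) (-(innerSL ℝ z)) x := fun x => 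
    (innerSL ℝ z).hasFDerivAt.const_sub 1
  rw [setInt_eq t1]
  have := integral_mul_fderiv_eq_neg_fderiv_mul_of_integrable (μ := volume)
    (f := fun x : EE N => 1 - inner ℝ z x) (g := φ) (v := v) ?_ ?_ ?_
    (fun x _ => (hd x).differentiableAt) (fun x _ => b1.differentiable (by simp) x)
  · rw [this]
    congr 1
    simp only [(hd _).fderiv]
    rw [← setInt_eq b3]
    apply integral_congr_ae; filter_upwards with x
    simp [real_inner_comm, mul_comm]
  · simp only [(hd _).fderiv]
    exact Continuous.integrable_of_hasCompactSupport (by fun_prop) b2.mul_left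
  · exact Continuous.integrable_of_hasCompactSupport (by fun_prop) hds.mul_left
  · exact Continuous.integrable_of_hasCompactSupport (by fun_prop) b2.mul_left

/-- Asymptotics of the Morrey-type constant: `lim_{p → ∞} μ_p(B_1)^{1/p} = 1`. -/
theorem muBall_asymptotics {N : ℕ} (hN : 0 < N)
    (z : EuclideanSpace ℝ (Fin N)) (hz : z ∈ Metric.sphere (0 : EuclideanSpace ℝ (Fin N)) 1) :
    Filter.Tendsto (fun p : ℝ => (muBall p z) ^ (1/p)) Filter.atTop (nhds 1) := by
  have hz1 : ‖z‖ = 1 := by simpa using hz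
  set V : ℝ := ∫ x in ball (0 : EE N) 1, (1:ℝ) with hV
  have hV0 : 0 < V := by
    rw [hV, setIntegral_const, smul_eq_mul, mul_one]
    exact ENNReal.toReal_pos (measure_ball_pos volume _ one_pos).ne' measure_ball_lt_top.ne
  have hmem : ∀ p : ℝ, V ∈ {E : ℝ | ∃ (u : EuclideanSpace ℝ (Fin N) → ℝ)
      (g : EuclideanSpace ℝ (Fin N) → EuclideanSpace ℝ (Fin N)),
    ContinuousOn u (Metric.closedBall (0 : EuclideanSpace ℝ (Fin N)) 1) ∧
    IsWeakGradOn (Metric.ball (0 : EuclideanSpace ℝ (Fin N)) 1) u g ∧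
    MeasureTheory.IntegrableOn u (Metric.ball (0 : EuclideanSpace ℝ (Fin N)) 1) ∧
    MeasureTheory.IntegrableOn (fun x => ‖g x‖ ^ p)
      (Metric.ball (0 : EuclideanSpace ℝ (Fin N)) 1) ∧
    u 0 = 1 ∧ u z = 0 ∧
    E = ∫ x in Metric.ball (0 : EuclideanSpace ℝ (Fin N)) 1, ‖g x‖ ^ p} := by
    intro p
    have hu : Continuous (fun x : EE N => 1 - inner ℝ z x) := by fun_prop
    refine ⟨fun x => 1 - inner ℝ z x, fun _ => -z, hu.continuousOn, linear_weak z,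
      intOn_of_cont hu, intOn_of_cont continuous_const, by simp, ?_, ?_⟩
    · simp [hz1]
    · simp [hz1, hV]
  have hnn : ∀ p : ℝ, 0 ≤ muBall p z := by
    intro p
    apply Real.sInf_nonneg
    rintro E ⟨u, g, -, -, -, -, -, -, rfl⟩
    exact integral_nonneg fun x => by positivity
  have hup : ∀ p : ℝ, muBall p z ≤ V := by
    intro p
    refine csInf_le ⟨0, ?_⟩ (hmem p)
    rintro E ⟨u, g, -, -, -, -, -, -, rfl⟩
    exact integral_nonneg fun x => by positivity
  have hroot : ∀ C : ℝ, 0 < C → Tendsto (fun p : ℝ => C ^ (1 / p)) atTop (nhds 1) := by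
    intro C hC
    have h1 : Tendsto (fun p : ℝ => 1 / p) atTop (nhds 0) := by
      simpa using tendsto_inv_atTop_zero (𝕜 := ℝ)
    have := (Real.continuousAt_const_rpow hC.ne' (b := 0)).tendsto.comp h1
    rw [Real.rpow_zero] at this
    exact this
  rw [tendsto_order]
  constructor
  · intro b hb
    obtain ⟨ρ, h0, h1, h2⟩ : ∃ ρ : ℝ, 0 < ρ ∧ ρ < 1 / 2 ∧ b < 1 / (1 + 2 * ρ) := by
      have hc : Tendsto (fun ρ : ℝ => 1 / (1 + 2 * ρ)) (nhdsWithin 0 (Ioi 0)) (nhds 1) := by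
        have : ContinuousAt (fun ρ : ℝ => 1 / (1 + 2 * ρ)) 0 :=
          ContinuousAt.div (by fun_prop) (by fun_prop) (by norm_num)
        have h := this.tendsto.mono_left (nhdsWithin_le_nhds (s := Ioi 0))
        simpa using h
      have e1 := hc.eventually (lt_mem_nhds hb)
      have e2 : ∀ᶠ ρ : ℝ in nhdsWithin 0 (Ioi 0), ρ ∈ Ioo (0:ℝ) (1/2) :=
        Ioo_mem_nhdsGT (by norm_num)
      obtain ⟨ρ, h3, h4⟩ := (e1.and e2).exists
      exact ⟨ρ, h4.1, h4.2, h3⟩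
    obtain ⟨M, hM, hlow⟩ := core_lower hz1 h0 h1
    have hlim : Tendsto (fun p : ℝ => (1 - N / p) / (1 + 2 * ρ) * (1 / M) ^ (1 / p)) atTop
        (nhds (1 / (1 + 2 * ρ))) := by
      have h3 : Tendsto (fun p : ℝ => (N : ℝ) / p) atTop (nhds 0) :=
        tendsto_const_nhds.div_atTop tendsto_id
      have := ((tendsto_const_nhds (x := (1:ℝ))).sub h3).div_const (1 + 2 * ρ)
      simpa using this.mul (hroot (1 / M) (by positivity))
    filter_upwards [hlim.eventually (lt_mem_nhds h2), eventually_gt_atTop (1:ℝ),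
      eventually_gt_atTop (N : ℝ)] with p hb hp hpN
    refine hb.trans_le ?_
    have hp0 : 0 < p := by linarith
    have hσ : 0 < 1 - N / p := by
      have : N / p < 1 := (div_lt_one hp0).2 hpN
      linarith
    have hA : 0 ≤ (1 - N / p) / (1 + 2 * ρ) := by positivity
    have hge : ((1 - N / p) / (1 + 2 * ρ)) ^ p / M ≤ muBall p z := by
      refine le_csInf ⟨V, hmem p⟩ ?_
      rintro E ⟨u, g, a1, a2, a3, a4, a5, a6, rfl⟩
      exact hlow p hp hpN u g a1 a2 a4 a5 a6
    calc _ = (((1 - N / p) / (1 + 2 * ρ)) ^ p / M) ^ (1 / p) := by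
          rw [div_eq_mul_one_div (_ ^ p) M, Real.mul_rpow (Real.rpow_nonneg hA p) (by positivity : (0:ℝ) ≤ 1 / M),
            ← Real.rpow_mul hA, mul_one_div_cancel hp0.ne', Real.rpow_one]
      _ ≤ _ := Real.rpow_le_rpow (by positivity) hge (by positivity)
  · intro b hb
    filter_upwards [(hroot V hV0).eventually (gt_mem_nhds hb), eventually_gt_atTop (0:ℝ)] with p h hp
    exact (Real.rpow_le_rpow (hnn p) (hup p) (by positivity)).trans_lt h
end

section
/- Let p > N and u ∈ W^{1,p}(B_R(x₀)), and let z ∈ ∂B_R(x₀). Then |u(x₀) - u(z)| ≤ R^{1-N/p} μ_p(B_1)^{-1/p} ‖∇u‖_{L^p(B_R(x₀))}, where μ_p(B_1) is the Morrey constant defined via the minimization on the unit ball with point constraints at the center and a boundary point. -/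
open Set Metric MeasureTheory

lemma mor_cov {N : ℕ} {F : Type*} [NormedAddCommGroup F] [NormedSpace ℝ F]
    (T : EuclideanSpace ℝ (Fin N) ≃ₗᵢ[ℝ] EuclideanSpace ℝ (Fin N))
    (x₀ : EuclideanSpace ℝ (Fin N)) (R : ℝ) (hR : 0 < R) (f : EuclideanSpace ℝ (Fin N) → F) :
    ∫ x in Metric.ball (0 : EuclideanSpace ℝ (Fin N)) 1, f (x₀ + R • T x) =
      (R ^ N)⁻¹ • ∫ x in Metric.ball x₀ R, f x := by
  rw [← integral_indicator measurableSet_ball, ← integral_indicator measurableSet_ball]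
  have h1 : (Metric.ball (0 : EuclideanSpace ℝ (Fin N)) 1).indicator (fun x => f (x₀ + R • T x)) =
      fun x => (fun y => (Metric.ball x₀ R).indicator f (x₀ + R • y)) (T x) := by
    funext x
    have : x ∈ Metric.ball (0 : EuclideanSpace ℝ (Fin N)) 1 ↔ x₀ + R • T x ∈ Metric.ball x₀ R := by
      simp [norm_smul, abs_of_pos hR, hR]
    by_cases hx : x ∈ Metric.ball (0 : EuclideanSpace ℝ (Fin N)) 1
    · simp [Set.indicator_of_mem hx, Set.indicator_of_mem (this.1 hx)]
    · simp [Set.indicator_of_notMem hx, Set.indicator_of_notMem (fun h => hx (this.2 h))]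
  rw [h1, T.measurePreserving.integral_comp T.toHomeomorph.measurableEmbedding,
    Measure.integral_comp_smul volume (fun y => (Metric.ball x₀ R).indicator f (x₀ + y)) R,
    integral_add_left_eq_self]
  simp [abs_of_pos hR]

lemma mor_cov_int {N : ℕ} {F : Type*} [NormedAddCommGroup F] [NormedSpace ℝ F]
    (T : EuclideanSpace ℝ (Fin N) ≃ₗᵢ[ℝ] EuclideanSpace ℝ (Fin N))
    (x₀ : EuclideanSpace ℝ (Fin N)) (R : ℝ) (hR : 0 < R) (f : EuclideanSpace ℝ (Fin N) → F)
    (hf : IntegrableOn f (Metric.ball x₀ R)) :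
    IntegrableOn (fun x => f (x₀ + R • T x)) (Metric.ball (0 : EuclideanSpace ℝ (Fin N)) 1) := by
  rw [← integrable_indicator_iff measurableSet_ball] at hf ⊢
  have h1 : (Metric.ball (0 : EuclideanSpace ℝ (Fin N)) 1).indicator (fun x => f (x₀ + R • T x)) =
      fun x => (fun y => (Metric.ball x₀ R).indicator f (x₀ + R • y)) (T x) := by
    funext x
    have : x ∈ Metric.ball (0 : EuclideanSpace ℝ (Fin N)) 1 ↔ x₀ + R • T x ∈ Metric.ball x₀ R := by
      simp [norm_smul, abs_of_pos hR, hR]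
    by_cases hx : x ∈ Metric.ball (0 : EuclideanSpace ℝ (Fin N)) 1
    · simp [Set.indicator_of_mem hx, Set.indicator_of_mem (this.1 hx)]
    · simp [Set.indicator_of_notMem hx, Set.indicator_of_notMem (fun h => hx (this.2 h))]
  rw [h1]
  refine (T.measurePreserving.integrable_comp_emb T.toHomeomorph.measurableEmbedding
    (g := fun y => (Metric.ball x₀ R).indicator f (x₀ + R • y))).2 ?_
  exact (hf.comp_add_left x₀).comp_smul hR.ne'

lemma mor_grad_comp {N : ℕ} (T : EuclideanSpace ℝ (Fin N) ≃ₗᵢ[ℝ] EuclideanSpace ℝ (Fin N))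
    (x₀ : EuclideanSpace ℝ (Fin N)) (R : ℝ) (φ : EuclideanSpace ℝ (Fin N) → ℝ)
    (hφ : Differentiable ℝ φ) (y : EuclideanSpace ℝ (Fin N)) :
    gradient (fun y => φ (T.symm (R⁻¹ • (y - x₀)))) y =
      R⁻¹ • T (gradient φ (T.symm (R⁻¹ • (y - x₀)))) := by
  apply HasGradientAt.gradient
  rw [hasGradientAt_iff_hasFDerivAt]
  have h1 := (hφ (T.symm (R⁻¹ • (y - x₀)))).hasGradientAt.hasFDerivAt
  have h2 : HasFDerivAt (fun y => T.symm (R⁻¹ • (y - x₀)))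
      ((T.symm.toContinuousLinearEquiv : EuclideanSpace ℝ (Fin N) →L[ℝ] EuclideanSpace ℝ (Fin N)).comp
        (R⁻¹ • ContinuousLinearMap.id ℝ _)) y := by
    have := (((hasFDerivAt_id (𝕜 := ℝ) y).sub_const x₀).const_smul R⁻¹)
    exact (T.symm.toContinuousLinearEquiv : EuclideanSpace ℝ (Fin N) →L[ℝ] EuclideanSpace ℝ (Fin N)).hasFDerivAt.comp y this
  refine (h1.comp y h2).congr_fderiv ?_
  ext v
  generalize gradient φ (T.symm (R⁻¹ • (y - x₀))) = w
  change inner ℝ w (T.symm (R⁻¹ • v)) = inner ℝ (R⁻¹ • T w) v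
  rw [← T.inner_map_map, T.apply_symm_apply, real_inner_smul_left, real_inner_smul_right]

lemma mor_int_grad {N : ℕ} (φ : EuclideanSpace ℝ (Fin N) → ℝ) (hφ : ContDiff ℝ (⊤ : ℕ∞) φ)
    (hs : HasCompactSupport φ) : ∫ x, gradient φ x = 0 := by
  have hd : Differentiable ℝ φ := hφ.differentiable (by simp)
  have hcf : Continuous (fderiv ℝ φ) := hφ.continuous_fderiv (by simp)
  have hg : gradient φ = fun x => (InnerProductSpace.toDual ℝ (EuclideanSpace ℝ (Fin N))).symm.toContinuousLinearEquiv
     (fderiv ℝ φ x) := rfl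
  rw [hg]
  have hi : Integrable (fderiv ℝ φ) := hcf.integrable_of_hasCompactSupport (hs.fderiv ℝ)
  have : ∫ x, fderiv ℝ φ x = 0 := by
    ext v
    rw [ContinuousLinearMap.integral_apply hi]
    have := integral_mul_fderiv_eq_neg_fderiv_mul_of_integrable (μ := volume) (f := fun _ => (1:ℝ)) (g := φ) (v := v)
      (by simp) (by simpa using hi.apply_continuousLinearMap v)
      (by simpa using hφ.continuous.integrable_of_hasCompactSupport hs) (by simp) (fun x _ => hd x)
    simpa using this
  have h3 := ContinuousLinearEquiv.integral_comp_comm (μ := volume) (𝕜 := ℝ)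
    (InnerProductSpace.toDual ℝ (EuclideanSpace ℝ (Fin N))).symm.toContinuousLinearEquiv (fderiv ℝ φ)
  rw [this] at h3
  simpa using h3

lemma mor_cont_grad {N : ℕ} (φ : EuclideanSpace ℝ (Fin N) → ℝ) (hφ : ContDiff ℝ (⊤ : ℕ∞) φ) :
    Continuous (gradient φ) := by
  have hcf : Continuous (fderiv ℝ φ) := hφ.continuous_fderiv (by simp)
  exact (InnerProductSpace.toDual ℝ (EuclideanSpace ℝ (Fin N))).symm.continuous.comp hcf

lemma mor_supp_grad {N : ℕ} (φ : EuclideanSpace ℝ (Fin N) → ℝ) :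
    Function.support (gradient φ) ⊆ tsupport φ := by
  intro x hx
  apply support_fderiv_subset ℝ
  intro h
  apply hx
  simp [gradient, h]

lemma mor_int_u_grad {N : ℕ} (u φ : EuclideanSpace ℝ (Fin N) → ℝ) (hφ : ContDiff ℝ (⊤ : ℕ∞) φ)
    (hs : HasCompactSupport φ) (S : Set (EuclideanSpace ℝ (Fin N))) (hu : IntegrableOn u S) :
    IntegrableOn (fun x => u x • gradient φ x) S := by
  have hc := mor_cont_grad φ hφ
  have hs' : HasCompactSupport (gradient φ) :=
    HasCompactSupport.of_support_subset_isCompact hs (mor_supp_grad φ)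
  obtain ⟨C, hC⟩ := hs'.exists_bound_of_continuous hc
  exact hu.smul_bdd C hc.aestronglyMeasurable (Filter.Eventually.of_forall hC)

lemma mor_scale {N : ℕ} (T : EuclideanSpace ℝ (Fin N) ≃ₗᵢ[ℝ] EuclideanSpace ℝ (Fin N))
    (x₀ : EuclideanSpace ℝ (Fin N)) (R : ℝ) (hR : 0 < R) (c d : ℝ)
    (u : EuclideanSpace ℝ (Fin N) → ℝ)
    (g : EuclideanSpace ℝ (Fin N) → EuclideanSpace ℝ (Fin N))
    (hw : IsWeakGradOn (Metric.ball x₀ R) u g)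
    (hui : MeasureTheory.IntegrableOn u (Metric.ball x₀ R)) :
    IsWeakGradOn (Metric.ball 0 1) (fun x => d * (u (x₀ + R • T x) - c))
      (fun x => (d * R) • T.symm (g (x₀ + R • T x))) := by
  intro φ hφ hs hsupp
  let Φ : EuclideanSpace ℝ (Fin N) ≃ₜ EuclideanSpace ℝ (Fin N) :=
    (T.toHomeomorph.trans (Homeomorph.smulOfNeZero R hR.ne')).trans (Homeomorph.addLeft x₀)
  have hΦ : ∀ x, Φ x = x₀ + R • T x := fun x => rfl
  have hinv : ∀ x, T.symm (R⁻¹ • ((x₀ + R • T x) - x₀)) = x := by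
    intro x; simp [smul_smul, hR.ne']
  have hΦs : ∀ y, Φ.symm y = T.symm (R⁻¹ • (y - x₀)) := by
    intro y
    rw [Homeomorph.symm_apply_eq, hΦ]; simp [smul_smul, hR.ne']
  have hψ : (fun y => φ (T.symm (R⁻¹ • (y - x₀)))) = φ ∘ Φ.symm := by
    funext y; simp [hΦs]
  have hd : Differentiable ℝ φ := hφ.differentiable (by simp)
  have key := hw (fun y => φ (T.symm (R⁻¹ • (y - x₀))))
    (hφ.comp (T.symm.contDiff.comp (by fun_prop)))
    (by rw [hψ]; exact hs.comp_homeomorph _)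
    (by
      rw [hψ, tsupport_comp_eq_preimage]
      intro y hy
      have := hsupp hy
      rw [hΦs] at this
      rw [mem_ball_zero_iff, T.symm.norm_map, norm_smul, norm_inv, Real.norm_of_nonneg hR.le] at this
      rw [inv_mul_lt_iff₀ hR] at this
      simpa [dist_eq_norm] using this)
  simp_rw [mor_grad_comp T x₀ R φ hd] at key
  have hRN : (R ^ N)⁻¹ ≠ 0 := by positivity
  have e1 := mor_cov T x₀ R hR (fun y => u y • R⁻¹ • T (gradient φ (T.symm (R⁻¹ • (y - x₀)))))
  have e2 := mor_cov T x₀ R hR (fun y => φ (T.symm (R⁻¹ • (y - x₀))) • g y)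
  simp only [hinv] at e1 e2
  rw [key, smul_neg, ← e2] at e1
  have hL : ∫ x in Metric.ball (0 : EuclideanSpace ℝ (Fin N)) 1, φ x • (d * R) • T.symm (g (x₀ + R • T x)) =
      (d * R) • T.symm.toContinuousLinearEquiv (∫ x in Metric.ball (0 : EuclideanSpace ℝ (Fin N)) 1, φ x • g (x₀ + R • T x)) := by
    rw [← ContinuousLinearEquiv.integral_comp_comm, ← integral_smul]
    congr 1; funext x
    simp [smul_comm (φ x)]
  have hL2 : ∫ x in Metric.ball (0 : EuclideanSpace ℝ (Fin N)) 1, u (x₀ + R • T x) • R⁻¹ • T (gradient φ x) =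
     R⁻¹ • T.toContinuousLinearEquiv (∫ x in Metric.ball (0 : EuclideanSpace ℝ (Fin N)) 1, u (x₀ + R • T x) • gradient φ x) := by
    rw [← ContinuousLinearEquiv.integral_comp_comm, ← integral_smul]
    congr 1; funext x
    simp [smul_comm R⁻¹]
  rw [hL2] at e1
  rw [hL]
  have i1 := mor_int_u_grad _ φ hφ hs _ (mor_cov_int T x₀ R hR u hui)
  have i2 : IntegrableOn (fun x => c • gradient φ x) (Metric.ball 0 1) :=
    mor_int_u_grad (fun _ => c) φ hφ hs _ (by
      rw [integrableOn_const_iff]; right; exact measure_ball_lt_top)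
  have hz : ∫ x in Metric.ball (0 : EuclideanSpace ℝ (Fin N)) 1, gradient φ x = 0 := by
    rw [setIntegral_eq_integral_of_forall_compl_eq_zero, mor_int_grad φ hφ hs]
    intro x hx
    by_contra h
    exact hx (hsupp (mor_supp_grad φ h))
  have : ∫ x in Metric.ball (0 : EuclideanSpace ℝ (Fin N)) 1, (d * (u (x₀ + R • T x) - c)) • gradient φ x
     = d • (∫ x in Metric.ball (0 : EuclideanSpace ℝ (Fin N)) 1, u (x₀ + R • T x) • gradient φ x) := by
    simp_rw [mul_smul, integral_smul, sub_smul]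
    rw [integral_sub i1 i2, integral_smul, hz]; simp
  rw [this]
  have e3 : T.toContinuousLinearEquiv (∫ x in Metric.ball (0 : EuclideanSpace ℝ (Fin N)) 1, u (x₀ + R • T x) • gradient φ x)
      = - R • ∫ x in Metric.ball (0 : EuclideanSpace ℝ (Fin N)) 1, φ x • g (x₀ + R • T x) := by
    rw [neg_smul, ← smul_neg, ← e1, smul_smul, mul_inv_cancel₀ hR.ne', one_smul]
  have e4 := congrArg T.symm e3
  simp at e4
  rw [e4]; simp [smul_smul]

lemma mor_W {N : ℕ} (a y : EuclideanSpace ℝ (Fin N)) (r : ℝ) (hr : 0 < r) :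
    r⁻¹ • (y - a) + a = r⁻¹ • (y - (1 - r) • a) := by
  rw [sub_smul, one_smul, smul_sub, smul_sub, smul_sub, smul_smul, inv_mul_cancel₀ hr.ne', one_smul]
  abel

/-- The test field component. -/
noncomputable def morPsi {N : ℕ} (φ : EuclideanSpace ℝ (Fin N) → ℝ) (a : EuclideanSpace ℝ (Fin N))
    (r : ℝ) (i : Fin N) (y : EuclideanSpace ℝ (Fin N)) : ℝ :=
  (r ^ (N+1))⁻¹ * (φ (r⁻¹ • (y - a) + a) * (y i - a i))

/-- The derivative in `r` of the kernel. -/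
noncomputable def morD {N : ℕ} (φ : EuclideanSpace ℝ (Fin N) → ℝ) (a : EuclideanSpace ℝ (Fin N))
    (r : ℝ) (y : EuclideanSpace ℝ (Fin N)) : ℝ :=
  -(N * (r ^ (N+1))⁻¹ * φ (r⁻¹ • (y - a) + a)
    + (r ^ (N+2))⁻¹ * fderiv ℝ φ (r⁻¹ • (y - a) + a) (y - a))

lemma morPsi_contDiff {N : ℕ} (φ : EuclideanSpace ℝ (Fin N) → ℝ) (hφ : ContDiff ℝ (⊤ : ℕ∞) φ)
    (a : EuclideanSpace ℝ (Fin N)) (r : ℝ) (i : Fin N) :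
    ContDiff ℝ (⊤ : ℕ∞) (morPsi φ a r i) := by
  unfold morPsi
  have h1 : ContDiff ℝ (⊤ : ℕ∞) (fun y : EuclideanSpace ℝ (Fin N) => φ (r⁻¹ • (y - a) + a)) :=
    hφ.comp (by fun_prop)
  have h2 : ContDiff ℝ (⊤ : ℕ∞) (fun y : EuclideanSpace ℝ (Fin N) => y i) :=
    (EuclideanSpace.proj (𝕜 := ℝ) i).contDiff
  exact contDiff_const.mul (h1.mul (h2.sub contDiff_const))

lemma morPsi_supp {N : ℕ} (φ : EuclideanSpace ℝ (Fin N) → ℝ)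
    (hsup : ∀ w, φ w ≠ 0 → ‖w‖ ≤ 1/2)
    (a : EuclideanSpace ℝ (Fin N)) (r : ℝ) (hr : 0 < r) (i : Fin N) :
    tsupport (morPsi φ a r i) ⊆ Metric.closedBall ((1 - r) • a) (r/2) := by
  apply closure_minimal _ isClosed_closedBall
  intro y hy
  have : φ (r⁻¹ • (y - a) + a) ≠ 0 := by
    intro h; apply hy; simp [morPsi, h]
  have := hsup _ this
  rw [mor_W a y r hr, norm_smul, norm_inv, Real.norm_of_nonneg hr.le, inv_mul_le_iff₀ hr] at this
  rw [mem_closedBall, dist_eq_norm]; linarith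

lemma mor_ball_sub {N : ℕ} (a : EuclideanSpace ℝ (Fin N)) (ha : ‖a‖ ≤ 1) (r : ℝ) (hr : 0 < r)
    (hr1 : r ≤ 1) : Metric.closedBall ((1 - r) • a) (r/2) ⊆ Metric.ball 0 1 := by
  intro y hy
  rw [mem_closedBall, dist_eq_norm] at hy
  rw [mem_ball_zero_iff]
  have h1 : ‖y‖ ≤ ‖y - (1 - r) • a‖ + ‖(1 - r) • a‖ := by
    simpa using norm_add_le (y - (1 - r) • a) ((1 - r) • a)
  rw [norm_smul, Real.norm_of_nonneg (by linarith : 0 ≤ 1 - r)] at h1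
  nlinarith

lemma mor_D_eq {N : ℕ} (φ : EuclideanSpace ℝ (Fin N) → ℝ) (hφ : ContDiff ℝ (⊤ : ℕ∞) φ)
    (a : EuclideanSpace ℝ (Fin N)) (r : ℝ) (hr : 0 < r) (y : EuclideanSpace ℝ (Fin N)) :
    morD φ a r y = - ∑ i, gradient (morPsi φ a r i) y i := by
  have hd : Differentiable ℝ φ := hφ.differentiable (by simp)
  have hgr : ∀ i, gradient (morPsi φ a r i) y i = (r ^ (N+1))⁻¹ * φ (r⁻¹ • (y - a) + a) +
      (r ^ (N+2))⁻¹ * ((y i - a i) * fderiv ℝ φ (r⁻¹ • (y - a) + a) (EuclideanSpace.single i 1)) := by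
    intro i
    have e1 : gradient (morPsi φ a r i) y i =
        fderiv ℝ (morPsi φ a r i) y (EuclideanSpace.single i 1) := by
      have h := ((morPsi_contDiff φ hφ a r i).differentiable (by simp) y).hasGradientAt.hasFDerivAt.fderiv
      rw [h, InnerProductSpace.toDual_apply_apply, EuclideanSpace.inner_single_right]
      simp
    have hW : HasFDerivAt (fun y : EuclideanSpace ℝ (Fin N) => r⁻¹ • (y - a) + a)
        (r⁻¹ • ContinuousLinearMap.id ℝ _) y :=
      (((hasFDerivAt_id (𝕜 := ℝ) y).sub_const a).const_smul r⁻¹).add_const a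
    have h1 := (hd (r⁻¹ • (y - a) + a)).hasFDerivAt.comp y hW
    have h2 : HasFDerivAt (fun y : EuclideanSpace ℝ (Fin N) => y i - a i)
        (EuclideanSpace.proj (𝕜 := ℝ) i : EuclideanSpace ℝ (Fin N) →L[ℝ] ℝ) y :=
      (EuclideanSpace.proj (𝕜 := ℝ) i : EuclideanSpace ℝ (Fin N) →L[ℝ] ℝ).hasFDerivAt.sub_const (a i)
    have h3 : HasFDerivAt (morPsi φ a r i) _ y := (h1.mul h2).const_mul ((r ^ (N+1))⁻¹)
    rw [e1, h3.fderiv]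
    simp
    generalize fderiv ℝ φ (r⁻¹ • (y - a) + a) (EuclideanSpace.single i 1) = A
    generalize φ (r⁻¹ • (y - a) + a) = B
    field_simp
    ring
  simp_rw [hgr]
  rw [Finset.sum_add_distrib, ← Finset.mul_sum, ← Finset.mul_sum]
  have hs : ∑ i, (y i - a i) * fderiv ℝ φ (r⁻¹ • (y - a) + a) (EuclideanSpace.single i 1) =
      fderiv ℝ φ (r⁻¹ • (y - a) + a) (y - a) := by
    generalize fderiv ℝ φ (r⁻¹ • (y - a) + a) = L
    conv_rhs => rw [← (EuclideanSpace.basisFun (Fin N) ℝ).sum_repr (y - a)]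
    simp [map_sum]
  rw [hs]
  simp [morD]
  ring

lemma mor_D_bound {N : ℕ} (u φ : EuclideanSpace ℝ (Fin N) → ℝ) (hφ : ContDiff ℝ (⊤ : ℕ∞) φ)
    (hsup : ∀ w, φ w ≠ 0 → ‖w‖ ≤ 1/2)
    (g : EuclideanSpace ℝ (Fin N) → EuclideanSpace ℝ (Fin N))
    (a : EuclideanSpace ℝ (Fin N)) (ha : ‖a‖ ≤ 1) (r : ℝ) (hr : 0 < r) (hr1 : r ≤ 1)
    (hw : IsWeakGradOn (Metric.ball 0 1) u g)
    (hui : MeasureTheory.IntegrableOn u (Metric.ball 0 1)) :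
    |∫ y in Metric.ball 0 1, u y * morD φ a r y| ≤
      ∑ i, ∫ y in Metric.ball 0 1, |morPsi φ a r i y| * ‖g y‖ := by
  have hcs : ∀ i, HasCompactSupport (morPsi φ a r i) := fun i =>
    HasCompactSupport.of_support_subset_isCompact (isCompact_closedBall _ _)
      ((subset_tsupport _).trans (morPsi_supp φ hsup a r hr i))
  have hint : ∀ i, IntegrableOn (fun x => u x • gradient (morPsi φ a r i) x) (Metric.ball 0 1) :=
    fun i => mor_int_u_grad u _ (morPsi_contDiff φ hφ a r i) (hcs i) _ hui
  have hint2 : ∀ i, IntegrableOn (fun x => u x * gradient (morPsi φ a r i) x i) (Metric.ball 0 1) := by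
    intro i
    exact (EuclideanSpace.proj (𝕜 := ℝ) i : EuclideanSpace ℝ (Fin N) →L[ℝ] ℝ).integrable_comp (hint i)
  have e : ∀ i, ∫ x in Metric.ball 0 1, u x * gradient (morPsi φ a r i) x i =
      (∫ x in Metric.ball 0 1, u x • gradient (morPsi φ a r i) x) i := by
    intro i
    exact (EuclideanSpace.proj (𝕜 := ℝ) i : EuclideanSpace ℝ (Fin N) →L[ℝ] ℝ).integral_comp_comm (hint i)
  simp_rw [mor_D_eq φ hφ a r hr, mul_neg, Finset.mul_sum, integral_neg, abs_neg]
  rw [integral_finsetSum _ (fun i _ => hint2 i)]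
  refine (Finset.abs_sum_le_sum_abs _ _).trans (Finset.sum_le_sum fun i _ => ?_)
  rw [e i, hw _ (morPsi_contDiff φ hφ a r i) (hcs i)
    ((morPsi_supp φ hsup a r hr i).trans (mor_ball_sub a ha r hr hr1))]
  refine (PiLp.norm_apply_le (p := 2) (β := fun _ : Fin N => ℝ) (-∫ x in Metric.ball 0 1, morPsi φ a r i x • g x) i).trans ?_
  rw [norm_neg]
  refine (norm_integral_le_integral_norm _).trans (le_of_eq ?_)
  simp [norm_smul]

lemma mor_deriv {N : ℕ} (u φ : EuclideanSpace ℝ (Fin N) → ℝ) (hφ : ContDiff ℝ (⊤ : ℕ∞) φ)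
    (a : EuclideanSpace ℝ (Fin N)) (r : ℝ) (hr : 0 < r)
    (hui : MeasureTheory.IntegrableOn u (Metric.ball 0 1)) :
    HasDerivAt (fun r => ∫ y in Metric.ball 0 1, u y * ((r ^ N)⁻¹ * φ (r⁻¹ • (y - a) + a)))
      (∫ y in Metric.ball 0 1, u y * morD φ a r y) r := by
  have hd : Differentiable ℝ φ := hφ.differentiable (by simp)
  have hcf : Continuous (fderiv ℝ φ) := hφ.continuous_fderiv (by simp)
  have hcφ := hφ.continuous
  have hK : IsCompact (Set.Icc (r/2) (2*r) ×ˢ Metric.closedBall (0 : EuclideanSpace ℝ (Fin N)) 1) :=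
    isCompact_Icc.prod (isCompact_closedBall _ _)
  have hW : ContinuousOn (fun q : ℝ × EuclideanSpace ℝ (Fin N) => q.1⁻¹ • (q.2 - a) + a)
      (Set.Icc (r/2) (2*r) ×ˢ Metric.closedBall (0 : EuclideanSpace ℝ (Fin N)) 1) := by
    refine ((ContinuousOn.inv₀ continuousOn_fst ?_).smul (by fun_prop)).add continuousOn_const
    rintro ⟨s, y⟩ ⟨hs, -⟩
    have : r/2 ≤ s := hs.1
    exact ne_of_gt (show 0 < s by linarith)
  have hinv : ∀ k : ℕ, ContinuousOn (fun q : ℝ × EuclideanSpace ℝ (Fin N) => (q.1 ^ k)⁻¹)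
      (Set.Icc (r/2) (2*r) ×ˢ Metric.closedBall (0 : EuclideanSpace ℝ (Fin N)) 1) := by
    intro k
    refine ContinuousOn.inv₀ (continuousOn_fst.pow k) ?_
    rintro ⟨s, y⟩ ⟨hs, -⟩
    have : r/2 ≤ s := hs.1
    exact pow_ne_zero _ (ne_of_gt (show 0 < s by linarith))
  have hD : ContinuousOn (fun q : ℝ × EuclideanSpace ℝ (Fin N) => morD φ a q.1 q.2)
      (Set.Icc (r/2) (2*r) ×ˢ Metric.closedBall (0 : EuclideanSpace ℝ (Fin N)) 1) := by
    unfold morD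
    refine (((continuousOn_const.mul (hinv _)).mul (hcφ.comp_continuousOn hW)).add
      ((hinv _).mul ((hcf.comp_continuousOn hW).clm_apply (by fun_prop)))).neg
  obtain ⟨C, hC⟩ := hK.exists_bound_of_continuousOn hD
  have hcD : ∀ s, Continuous (morD φ a s) := by
    intro s; unfold morD; fun_prop
  have hcker : ∀ s : ℝ, Continuous (fun y : EuclideanSpace ℝ (Fin N) => (s ^ N)⁻¹ * φ (s⁻¹ • (y - a) + a)) := by
    intro s; fun_prop
  refine (hasDerivAt_integral_of_dominated_loc_of_deriv_le (s := Set.Ioo (r/2) (2*r))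
    (F' := fun s y => u y * morD φ a s y) (bound := fun y => ‖u y‖ * C)
    (Ioo_mem_nhds (by linarith) (by linarith)) ?_ ?_ ?_ ?_ ?_ ?_).2
  · exact Filter.Eventually.of_forall fun s =>
      hui.aestronglyMeasurable.mul (hcker s).aestronglyMeasurable
  · obtain ⟨C', hC'⟩ := (isCompact_closedBall (0 : EuclideanSpace ℝ (Fin N)) 1).exists_bound_of_continuousOn
      (hcker r).continuousOn
    refine Integrable.mul_bdd (c := C') hui (hcker r).aestronglyMeasurable ?_
    filter_upwards [ae_restrict_mem measurableSet_ball] with y hy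
    exact hC' y (ball_subset_closedBall hy)
  · exact hui.aestronglyMeasurable.mul (hcD r).aestronglyMeasurable
  · filter_upwards [ae_restrict_mem measurableSet_ball] with y hy
    intro s hs
    rw [norm_mul]
    exact mul_le_mul_of_nonneg_left (hC (s, y) ⟨⟨hs.1.le, hs.2.le⟩, ball_subset_closedBall hy⟩) (norm_nonneg _)
  · exact Integrable.mul_const hui.norm C
  · refine Filter.Eventually.of_forall fun y s hs => ?_
    have hs0 : 0 < s := by have := hs.1; linarith
    refine HasDerivAt.const_mul (u y) ?_
    have h1 : HasDerivAt (fun s : ℝ => s⁻¹ • (y - a) + a) ((-(s^2)⁻¹) • (y - a)) s :=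
      ((hasDerivAt_inv hs0.ne').smul_const (y - a)).add_const a
    have h2 := (hd (s⁻¹ • (y - a) + a)).hasFDerivAt.comp_hasDerivAt s h1
    have h3 : HasDerivAt (fun s : ℝ => (s ^ N)⁻¹) _ s :=
      ((hasDerivAt_pow N s).inv (pow_ne_zero _ hs0.ne'))
    refine (h3.mul h2).congr_deriv ?_
    simp only [morD, map_smul, smul_eq_mul, Function.comp]
    generalize φ (s⁻¹ • (y - a) + a) = A
    generalize fderiv ℝ φ (s⁻¹ • (y - a) + a) (y - a) = B
    rcases N with _ | n
    · simp; 
    · simp; field_simp; ring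

lemma mor_holder {N : ℕ} (hN : 0 < N) (p : ℝ) (hp : (N : ℝ) < p)
    (g : EuclideanSpace ℝ (Fin N) → EuclideanSpace ℝ (Fin N))
    (hgi : IntegrableOn (fun x => ‖g x‖ ^ p) (Metric.ball (0 : EuclideanSpace ℝ (Fin N)) 1))
    (a : EuclideanSpace ℝ (Fin N)) (ρ : ℝ) (hρ : 0 ≤ ρ) :
    IntegrableOn (fun x => ‖g x‖) (Metric.ball (0 : EuclideanSpace ℝ (Fin N)) 1) ∧
    ∫ y in Metric.ball 0 1, ‖g y‖ * (Metric.closedBall a ρ).indicator 1 y ≤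
      (∫ x in Metric.ball (0 : EuclideanSpace ℝ (Fin N)) 1, ‖g x‖ ^ p) ^ (1/p) *
      (ρ ^ N * volume.real (Metric.ball (0 : EuclideanSpace ℝ (Fin N)) 1)) ^ (1 - 1/p) := by
  have hN1 : (1:ℝ) ≤ N := by exact_mod_cast hN
  have hp1 : 1 < p := by linarith
  have hp0 : 0 < p := by linarith
  have hm : AEStronglyMeasurable (fun x => ‖g x‖)
      (volume.restrict (Metric.ball (0 : EuclideanSpace ℝ (Fin N)) 1)) := by
    have := (hgi.aestronglyMeasurable.aemeasurable.pow_const (1/p)).aestronglyMeasurable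
    refine this.congr (Filter.Eventually.of_forall fun x => ?_)
    simp only
    rw [← Real.rpow_mul (norm_nonneg _), mul_one_div_cancel hp0.ne', Real.rpow_one]
  have hL : MemLp (fun x => ‖g x‖) (ENNReal.ofReal p)
      (volume.restrict (Metric.ball (0 : EuclideanSpace ℝ (Fin N)) 1)) := by
    rw [← integrable_norm_rpow_iff hm (by simpa using hp0) (by simp)]
    simpa [ENNReal.toReal_ofReal hp0.le, IntegrableOn] using hgi
  have : IsFiniteMeasure (volume.restrict (Metric.ball (0 : EuclideanSpace ℝ (Fin N)) 1)) :=
    ⟨by simpa using measure_ball_lt_top⟩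
  have hq := Real.HolderConjugate.conjExponent hp1
  refine ⟨hL.integrable (by simpa using hp1.le), ?_⟩
  have hL2 : MemLp ((Metric.closedBall a ρ).indicator (1 : EuclideanSpace ℝ (Fin N) → ℝ))
      (ENNReal.ofReal p.conjExponent)
      (volume.restrict (Metric.ball (0 : EuclideanSpace ℝ (Fin N)) 1)) :=
    memLp_indicator_const _ measurableSet_closedBall (1:ℝ) (Or.inr (measure_ne_top _ _))
  refine (integral_mul_le_Lp_mul_Lq_of_nonneg hq (Filter.Eventually.of_forall fun x => norm_nonneg _)
    (Filter.Eventually.of_forall fun x => Set.indicator_nonneg (by simp) x) hL hL2).trans ?_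
  have hq' : 1 / p.conjExponent = 1 - 1/p := by
    have := hq.inv_add_inv_eq_one
    simp only [one_div]; linarith
  rw [hq']
  have hq0 : 0 ≤ 1 - 1/p := by rw [← hq']; exact (one_div_pos.2 hq.symm.pos).le
  have e : ∀ y, (Metric.closedBall a ρ).indicator (1 : EuclideanSpace ℝ (Fin N) → ℝ) y ^ p.conjExponent
      = (Metric.closedBall a ρ).indicator (1 : EuclideanSpace ℝ (Fin N) → ℝ) y := by
    intro y
    by_cases hy : y ∈ Metric.closedBall a ρ
    · simp [Set.indicator_of_mem hy]
    · simp [Set.indicator_of_notMem hy, Real.zero_rpow hq.symm.pos.ne']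
  simp_rw [e]
  have hV : volume.real (Metric.closedBall a ρ) = ρ ^ N * volume.real (Metric.ball (0 : EuclideanSpace ℝ (Fin N)) 1) := by
    rw [Measure.addHaar_real_closedBall _ _ hρ]; simp
  rw [integral_indicator_one measurableSet_closedBall, ← hV]
  have hle : (volume.restrict (Metric.ball (0 : EuclideanSpace ℝ (Fin N)) 1)).real (Metric.closedBall a ρ) ≤
      volume.real (Metric.closedBall a ρ) :=
    ENNReal.toReal_mono measure_closedBall_lt_top.ne (Measure.restrict_apply_le _ _)
  gcongr

lemma mor_C {N : ℕ} (hN : 0 < N) (p : ℝ) (hp : (N : ℝ) < p)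
    (φ : EuclideanSpace ℝ (Fin N) → ℝ) (hφ : ContDiff ℝ (⊤ : ℕ∞) φ)
    (h01 : ∀ w, 0 ≤ φ w ∧ φ w ≤ 1)
    (hsup : ∀ w, φ w ≠ 0 → ‖w‖ ≤ 1/2)
    (g : EuclideanSpace ℝ (Fin N) → EuclideanSpace ℝ (Fin N))
    (hgi : IntegrableOn (fun x => ‖g x‖ ^ p) (Metric.ball (0 : EuclideanSpace ℝ (Fin N)) 1))
    (a : EuclideanSpace ℝ (Fin N)) (ha : ‖a‖ ≤ 1) (r : ℝ) (hr : 0 < r) :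
    ∑ i, ∫ y in Metric.ball 0 1, |morPsi φ a r i y| * ‖g y‖ ≤
     (2 * N * (2 ^ N * volume.real (Metric.ball (0 : EuclideanSpace ℝ (Fin N)) 1)) ^ (1 - 1/p) *
      (∫ x in Metric.ball (0 : EuclideanSpace ℝ (Fin N)) 1, ‖g x‖ ^ p) ^ (1/p)) * r ^ (-(N/p)) := by
  obtain ⟨hgI, hH⟩ := mor_holder hN p hp g hgi a (2*r) (by positivity)
  set V := volume.real (Metric.ball (0 : EuclideanSpace ℝ (Fin N)) 1)
  have hV0 : 0 ≤ V := measureReal_nonneg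
  set G := (∫ x in Metric.ball (0 : EuclideanSpace ℝ (Fin N)) 1, ‖g x‖ ^ p) ^ (1/p)
  have hpt : ∀ i y, |morPsi φ a r i y| ≤ 2 * (r^N)⁻¹ * (Metric.closedBall a (2*r)).indicator 1 y := by
    intro i y
    by_cases h0 : φ (r⁻¹ • (y - a) + a) = 0
    · simp only [morPsi, h0]
      simp only [zero_mul, mul_zero, abs_zero]
      have : 0 ≤ (Metric.closedBall a (2*r)).indicator (1 : EuclideanSpace ℝ (Fin N) → ℝ) y :=
        Set.indicator_nonneg (by simp) y
      positivity
    · have h1 := hsup _ h0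
      have h2 : ‖r⁻¹ • (y - a)‖ ≤ 2 := by
        have := norm_sub_le (r⁻¹ • (y - a) + a) a
        rw [add_sub_cancel_right] at this
        linarith
      rw [norm_smul, norm_inv, Real.norm_of_nonneg hr.le, inv_mul_le_iff₀ hr] at h2
      have hy : y ∈ Metric.closedBall a (2*r) := by
        rw [mem_closedBall, dist_eq_norm]; linarith
      rw [Set.indicator_of_mem hy]
      have h3 : |y i - a i| ≤ 2 * r := by
        have := PiLp.norm_apply_le (p := 2) (β := fun _ : Fin N => ℝ) (y - a) i
        rw [Real.norm_eq_abs] at this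
        simp only [PiLp.sub_apply] at this
        linarith
      have h4 : |φ (r⁻¹ • (y - a) + a)| ≤ 1 := by
        rw [abs_of_nonneg (h01 _).1]; exact (h01 _).2
      rw [morPsi, abs_mul, abs_mul, abs_of_pos (by positivity : 0 < (r^(N+1))⁻¹)]
      calc (r^(N+1))⁻¹ * (|φ (r⁻¹ • (y - a) + a)| * |y i - a i|) ≤ (r^(N+1))⁻¹ * (1 * (2 * r)) := by gcongr
        _ = _ := by simp; field_simp; ring
  have hterm : ∀ i, ∫ y in Metric.ball 0 1, |morPsi φ a r i y| * ‖g y‖ ≤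
      2 * (r^N)⁻¹ * (G * ((2*r)^N * V) ^ (1 - 1/p)) := by
    intro i
    refine le_trans ?_ (mul_le_mul_of_nonneg_left hH (by positivity))
    rw [← integral_const_mul]
    refine integral_mono_of_nonneg (Filter.Eventually.of_forall fun y => by positivity) ?_
      (Filter.Eventually.of_forall fun y => ?_)
    · refine Integrable.const_mul ?_ _
      refine Integrable.mul_bdd (c := 1) hgI
        (((stronglyMeasurable_const (b := (1:ℝ))).indicator measurableSet_closedBall).aestronglyMeasurable) 
        (Filter.Eventually.of_forall fun y => ?_)
      exact (norm_indicator_le_norm_self _ _).trans (by simp)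
    · have := mul_le_mul_of_nonneg_right (hpt i y) (norm_nonneg (g y))
      simp only
      linarith
  refine (Finset.sum_le_sum fun i _ => hterm i).trans (le_of_eq ?_)
  rw [Finset.sum_const, Finset.card_univ, Fintype.card_fin, nsmul_eq_mul, mul_pow]
  have e1 : (2^N * r^N * V) = (2^N * V) * r^N := by ring
  rw [e1, Real.mul_rpow (by positivity) (by positivity), ← Real.rpow_natCast r N, ← Real.rpow_mul hr.le,
    ← Real.rpow_neg hr.le]
  have e2 : r ^ (-(N/p)) = r ^ (-(N:ℝ)) * r ^ ((N:ℝ) * (1 - 1/p)) := by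
    rw [← Real.rpow_add hr]; congr 1; ring
  rw [e2]; ring

lemma mor_lim {N : ℕ} (u φ : EuclideanSpace ℝ (Fin N) → ℝ) (hφ : Continuous φ)
    (h01 : ∀ w, 0 ≤ φ w ∧ φ w ≤ 1)
    (hsup : ∀ w, φ w ≠ 0 → ‖w‖ ≤ 1/2)
    (hc : ContinuousOn u (Metric.closedBall 0 1))
    (a : EuclideanSpace ℝ (Fin N)) (ha : ‖a‖ ≤ 1) :
    Filter.Tendsto (fun r : ℝ => ∫ y in Metric.ball 0 1, u y * ((r ^ N)⁻¹ * φ (r⁻¹ • (y - a) + a)))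
      (nhdsWithin 0 (Set.Ioi 0)) (nhds (∫ x in Metric.ball 0 1, u a * φ x)) := by
  have hmem : ∀ r : ℝ, 0 < r → r ≤ 1 → ∀ x ∈ Metric.closedBall (0 : EuclideanSpace ℝ (Fin N)) 1,
      (1 - r) • a + r • x ∈ Metric.closedBall (0 : EuclideanSpace ℝ (Fin N)) 1 := by
    intro r hr hr1 x hx
    exact convex_closedBall (0 : EuclideanSpace ℝ (Fin N)) 1 (by simpa using ha) hx (by linarith) hr.le (by ring)
  have heq : ∀ r : ℝ, 0 < r → r ≤ 1 →
      ∫ y in Metric.ball 0 1, u y * ((r ^ N)⁻¹ * φ (r⁻¹ • (y - a) + a)) =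
      ∫ x in Metric.ball 0 1, u ((1 - r) • a + r • x) * φ x := by
    intro r hr hr1
    have h := mor_cov (LinearIsometryEquiv.refl ℝ _) ((1 - r) • a) r hr
      (fun y => u y * φ (r⁻¹ • (y - a) + a))
    have h2 : ∀ x, r⁻¹ • ((1 - r) • a + r • x - a) + a = x := by
      intro x
      rw [mor_W _ _ _ hr, add_sub_cancel_left, smul_smul, inv_mul_cancel₀ hr.ne', one_smul]
    simp only [LinearIsometryEquiv.coe_refl, id, h2] at h
    rw [h, ← setIntegral_eq_of_subset_of_forall_sdiff_eq_zero (s := Metric.ball ((1 - r) • a) r)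
      (t := Metric.ball 0 1) measurableSet_ball, smul_eq_mul, ← integral_const_mul]
    · congr 1; funext y; ring
    · intro y hy
      rw [mem_ball, dist_eq_norm] at hy
      rw [mem_ball_zero_iff]
      have h1 : ‖y‖ ≤ ‖y - (1 - r) • a‖ + ‖(1 - r) • a‖ := by
        simpa using norm_add_le (y - (1 - r) • a) ((1 - r) • a)
      rw [norm_smul, Real.norm_of_nonneg (by linarith : 0 ≤ 1 - r)] at h1
      nlinarith
    · rintro y ⟨-, hy⟩
      by_contra h0
      have h1 := hsup _ (right_ne_zero_of_mul h0)
      rw [mor_W a y r hr, norm_smul, norm_inv, Real.norm_of_nonneg hr.le, inv_mul_le_iff₀ hr] at h1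
      apply hy
      rw [mem_ball, dist_eq_norm]; linarith
  have hev : ∀ᶠ r : ℝ in nhdsWithin 0 (Set.Ioi 0), 0 < r ∧ r ≤ 1 := by
    filter_upwards [Ioo_mem_nhdsGT (show (0:ℝ) < 1 by norm_num)] with r hr
    exact ⟨hr.1, hr.2.le⟩
  refine Filter.Tendsto.congr' (f₁ := fun r : ℝ => ∫ x in Metric.ball 0 1, u ((1 - r) • a + r • x) * φ x)
    (hev.mono fun r hr => (heq r hr.1 hr.2).symm) ?_
  obtain ⟨C, hC⟩ := (isCompact_closedBall (0 : EuclideanSpace ℝ (Fin N)) 1).exists_bound_of_continuousOn hc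
  have hcomp : ∀ r : ℝ, 0 < r → r ≤ 1 → ContinuousOn (fun x => u ((1 - r) • a + r • x))
      (Metric.closedBall (0 : EuclideanSpace ℝ (Fin N)) 1) := fun r hr hr1 =>
    hc.comp (by fun_prop) (hmem r hr hr1)
  refine tendsto_integral_filter_of_dominated_convergence (fun _ => C) ?_ ?_ ?_ ?_
  · filter_upwards [hev] with r hr
    exact (((hcomp r hr.1 hr.2).mul hφ.continuousOn).mono ball_subset_closedBall).aestronglyMeasurable measurableSet_ball
  · filter_upwards [hev] with r hr
    filter_upwards [ae_restrict_mem measurableSet_ball] with x hx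
    have h1 := hC _ (hmem r hr.1 hr.2 x (ball_subset_closedBall hx))
    rw [norm_mul, Real.norm_of_nonneg (h01 x).1]
    nlinarith [norm_nonneg (u ((1 - r) • a + r • x)), h01 x]
  · have : IntegrableOn (fun _ : EuclideanSpace ℝ (Fin N) => C) (Metric.ball 0 1) := by
      rw [integrableOn_const_iff]; right; exact measure_ball_lt_top
    exact this
  · filter_upwards [ae_restrict_mem measurableSet_ball] with x hx
    refine Filter.Tendsto.mul_const _ ?_
    have h1 : Filter.Tendsto u (nhdsWithin a (Metric.closedBall 0 1)) (nhds (u a)) :=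
      hc a (by simpa using ha)
    refine h1.comp (tendsto_nhdsWithin_iff.2 ⟨?_, ?_⟩)
    · have : Continuous (fun r : ℝ => (1 - r) • a + r • x) := by fun_prop
      have := this.tendsto 0
      simp only [sub_zero, one_smul, zero_smul, add_zero] at this
      exact this.mono_left nhdsWithin_le_nhds
    · exact hev.mono fun r hr => hmem r hr.1 hr.2 x (ball_subset_closedBall hx)

lemma mor_point {N : ℕ} (hN : 0 < N) (p : ℝ) (hp : (N : ℝ) < p)
    (φ : EuclideanSpace ℝ (Fin N) → ℝ) (hφ : ContDiff ℝ (⊤ : ℕ∞) φ)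
    (h01 : ∀ w, 0 ≤ φ w ∧ φ w ≤ 1)
    (hsup : ∀ w, φ w ≠ 0 → ‖w‖ ≤ 1/2)
    (u : EuclideanSpace ℝ (Fin N) → ℝ)
    (g : EuclideanSpace ℝ (Fin N) → EuclideanSpace ℝ (Fin N))
    (hc : ContinuousOn u (Metric.closedBall 0 1))
    (hw : IsWeakGradOn (Metric.ball 0 1) u g)
    (hui : MeasureTheory.IntegrableOn u (Metric.ball 0 1))
    (hgi : IntegrableOn (fun x => ‖g x‖ ^ p) (Metric.ball (0 : EuclideanSpace ℝ (Fin N)) 1))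
    (a : EuclideanSpace ℝ (Fin N)) (ha : ‖a‖ ≤ 1) :
    |(∫ y in Metric.ball 0 1, u y * φ y) - u a * ∫ x in Metric.ball 0 1, φ x| ≤
     (2 * N * (2 ^ N * volume.real (Metric.ball (0 : EuclideanSpace ℝ (Fin N)) 1)) ^ (1 - 1/p) *
      (∫ x in Metric.ball (0 : EuclideanSpace ℝ (Fin N)) 1, ‖g x‖ ^ p) ^ (1/p)) / (1 - N/p) := by
  have hN1 : (1:ℝ) ≤ N := by exact_mod_cast hN
  have hp0 : 0 < p := by linarith
  have hs : 0 < 1 - N/p := by rw [sub_pos, div_lt_one hp0]; exact hp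
  have hC := mor_C hN p hp φ hφ h01 hsup g hgi a ha
  set C := (2 * N * (2 ^ N * volume.real (Metric.ball (0 : EuclideanSpace ℝ (Fin N)) 1)) ^ (1 - 1/p) *
      (∫ x in Metric.ball (0 : EuclideanSpace ℝ (Fin N)) 1, ‖g x‖ ^ p) ^ (1/p)) with hCdef
  have hC0 : 0 ≤ C := by
    have : 0 ≤ ∫ x in Metric.ball (0 : EuclideanSpace ℝ (Fin N)) 1, ‖g x‖ ^ p :=
      integral_nonneg fun x => by positivity
    positivity
  set m : ℝ → ℝ := fun r => ∫ y in Metric.ball 0 1, u y * ((r ^ N)⁻¹ * φ (r⁻¹ • (y - a) + a)) with hm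
  have hder := fun r hr => mor_deriv u φ hφ a r hr hui
  have hlim := mor_lim u φ hφ.continuous h01 hsup hc a ha
  rw [integral_const_mul] at hlim
  have hm1 : m 1 = ∫ y in Metric.ball 0 1, u y * φ y := by simp [hm]
  have key : ∀ ε : ℝ, 0 < ε → ε < 1 → |m 1 - m ε| ≤ C / (1 - N/p) := by
    intro ε h0 h1
    have := image_norm_le_of_norm_deriv_right_le_deriv_boundary' (f := fun r => m r - m ε) (a := ε) (b := 1)
      (f' := fun r => ∫ y in Metric.ball 0 1, u y * morD φ a r y)
      (B := fun r => C / (1 - N/p) * r ^ (1 - N/p)) (B' := fun r => C * r ^ (-(N/p)))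
      (fun r hr => ((hder r (h0.trans_le hr.1)).continuousAt.continuousWithinAt).sub continuousWithinAt_const)
      (fun r hr => ((hder r (h0.trans_le hr.1)).hasDerivWithinAt).sub_const _)
      (by simp only [sub_self, norm_zero]; positivity)
      (fun r hr => ((Real.continuousAt_rpow_const r _ (Or.inl (h0.trans_le hr.1).ne')).continuousWithinAt).const_mul _)
      (fun r hr => by
        have h := ((Real.hasDerivAt_rpow_const (p := 1 - N/p) (Or.inl (h0.trans_le hr.1).ne')).const_mul (C / (1 - N/p)))
        refine (h.congr_deriv ?_).hasDerivWithinAt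
        rw [show (1 - N/p - 1 : ℝ) = -(N/p) by ring, ← mul_assoc, div_mul_cancel₀ _ hs.ne'])
      (fun r hr => (mor_D_bound u φ hφ hsup g a ha r (h0.trans_le hr.1) hr.2.le hw hui).trans
        (hC r (h0.trans_le hr.1)))
      (x := 1) ⟨h1.le, le_rfl⟩
    simpa using this
  rw [← hm1]
  refine le_of_tendsto (hlim.const_sub (m 1)).abs ?_
  filter_upwards [Ioo_mem_nhdsGT (show (0:ℝ) < 1 by norm_num)] with r hr
  exact key r hr.1 hr.2

lemma mor_pos {N : ℕ} (hN : 0 < N) (p : ℝ) (hp : (N : ℝ) < p) :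
    ∃ c : ℝ, 0 < c ∧ ∀ (u : EuclideanSpace ℝ (Fin N) → ℝ)
      (g : EuclideanSpace ℝ (Fin N) → EuclideanSpace ℝ (Fin N)) (z : EuclideanSpace ℝ (Fin N)),
      ‖z‖ ≤ 1 → ContinuousOn u (Metric.closedBall 0 1) →
      IsWeakGradOn (Metric.ball 0 1) u g → IntegrableOn u (Metric.ball 0 1) →
      IntegrableOn (fun x => ‖g x‖ ^ p) (Metric.ball (0 : EuclideanSpace ℝ (Fin N)) 1) →
      u 0 = 1 → u z = 0 →
      c ≤ ∫ x in Metric.ball (0 : EuclideanSpace ℝ (Fin N)) 1, ‖g x‖ ^ p := by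
  have hN1 : (1:ℝ) ≤ N := by exact_mod_cast hN
  have hp0 : 0 < p := by linarith
  have hs : 0 < 1 - N/p := by rw [sub_pos, div_lt_one hp0]; exact hp
  let φ : ContDiffBump (0 : EuclideanSpace ℝ (Fin N)) := ⟨1/4, 1/2, by norm_num, by norm_num⟩
  have hsup : ∀ w, φ w ≠ 0 → ‖w‖ ≤ 1/2 := by
    intro w hw
    have : w ∈ Function.support φ := hw
    rw [φ.support_eq, mem_ball_zero_iff] at this
    exact this.le
  have hI : 0 < ∫ x in Metric.ball (0 : EuclideanSpace ℝ (Fin N)) 1, φ x := by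
    rw [setIntegral_eq_integral_of_forall_compl_eq_zero]
    · exact φ.integral_pos
    · intro x hx
      by_contra h
      apply hx
      have := hsup x h
      rw [mem_ball_zero_iff]; linarith
  set I := ∫ x in Metric.ball (0 : EuclideanSpace ℝ (Fin N)) 1, φ x
  set K := 2 * N * (2 ^ N * volume.real (Metric.ball (0 : EuclideanSpace ℝ (Fin N)) 1)) ^ (1 - 1/p) with hK
  have hV : 0 < volume.real (Metric.ball (0 : EuclideanSpace ℝ (Fin N)) 1) :=
    ENNReal.toReal_pos (measure_ball_pos _ _ (by norm_num)).ne' measure_ball_lt_top.ne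
  have hK0 : 0 < K := by positivity
  refine ⟨(I * (1 - N/p) / (2 * K)) ^ p, by positivity, ?_⟩
  intro u g z hz hc hw hui hgi h0 h1
  have A := mor_point hN p hp φ φ.contDiff (fun w => ⟨φ.nonneg, φ.le_one⟩) hsup u g hc hw hui hgi 0 (by simp)
  have B := mor_point hN p hp φ φ.contDiff (fun w => ⟨φ.nonneg, φ.le_one⟩) hsup u g hc hw hui hgi z hz
  rw [h0, one_mul] at A
  rw [h1, zero_mul] at B
  rw [← hK] at A B
  change |_ - I| ≤ _ at A
  have hE : 0 ≤ ∫ x in Metric.ball (0 : EuclideanSpace ℝ (Fin N)) 1, ‖g x‖ ^ p :=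
      integral_nonneg fun x => by positivity
  set E := ∫ x in Metric.ball (0 : EuclideanSpace ℝ (Fin N)) 1, ‖g x‖ ^ p
  have h3 : I ≤ 2 * (K * E ^ (1/p) / (1 - N/p)) := by
    have a1 := abs_le.1 A
    have b1 := abs_le.1 B
    linarith [a1.1, b1.2]
  have h4 : I * (1 - N/p) / (2 * K) ≤ E ^ (1/p) := by
    rw [div_le_iff₀ (by positivity)]
    have := mul_le_mul_of_nonneg_right h3 hs.le
    refine this.trans (le_of_eq ?_)
    rw [mul_assoc, div_mul_cancel₀ _ hs.ne']
    ring
  calc (I * (1 - N/p) / (2 * K)) ^ p ≤ (E ^ (1/p)) ^ p := by gcongr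
    _ = E := by rw [← Real.rpow_mul hE, one_div_mul_cancel hp0.ne', Real.rpow_one]

/-- Morrey-type estimate: for `p > N`, `u ∈ W^{1,p}(B_R(x₀))` and `z ∈ ∂B_R(x₀)`,
`|u(x₀) - u(z)| ≤ R^{1-N/p} μ_p(B_1)^{-1/p} ‖∇u‖_{L^p(B_R(x₀))}`. -/
theorem morrey_estimate_center_boundary {N : ℕ} (hN : 0 < N) (p : ℝ) (hp : (N : ℝ) < p)
    (z' : EuclideanSpace ℝ (Fin N)) (hz' : z' ∈ Metric.sphere (0 : EuclideanSpace ℝ (Fin N)) 1)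
    (x₀ z : EuclideanSpace ℝ (Fin N)) (R : ℝ) (hR : 0 < R) (hz : z ∈ Metric.sphere x₀ R)
    (u : EuclideanSpace ℝ (Fin N) → ℝ)
    (g : EuclideanSpace ℝ (Fin N) → EuclideanSpace ℝ (Fin N))
    (hc : ContinuousOn u (Metric.closedBall x₀ R))
    (hw : IsWeakGradOn (Metric.ball x₀ R) u g)
    (hui : MeasureTheory.IntegrableOn u (Metric.ball x₀ R))
    (hgi : MeasureTheory.IntegrableOn (fun x => ‖g x‖ ^ p) (Metric.ball x₀ R)) :
    |u x₀ - u z| ≤ R ^ (1 - (N : ℝ)/p) * (muBall p z') ^ (-(1/p)) *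
      (∫ x in Metric.ball x₀ R, ‖g x‖ ^ p) ^ (1/p) := by
  have hN1 : (1:ℝ) ≤ N := by exact_mod_cast hN
  have hp0 : 0 < p := by linarith
  have hz1 : ‖z - x₀‖ = R := by simpa [dist_eq_norm] using hz
  have hz2 : ‖z'‖ = 1 := by simpa using hz'
  obtain ⟨c, hc0, hcm⟩ := mor_pos hN p hp
  have hlow : ∀ E ∈ {E : ℝ | ∃ (u : EuclideanSpace ℝ (Fin N) → ℝ)
      (g : EuclideanSpace ℝ (Fin N) → EuclideanSpace ℝ (Fin N)),
      ContinuousOn u (Metric.closedBall (0 : EuclideanSpace ℝ (Fin N)) 1) ∧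
      IsWeakGradOn (Metric.ball (0 : EuclideanSpace ℝ (Fin N)) 1) u g ∧
      MeasureTheory.IntegrableOn u (Metric.ball (0 : EuclideanSpace ℝ (Fin N)) 1) ∧
      MeasureTheory.IntegrableOn (fun x => ‖g x‖ ^ p)
        (Metric.ball (0 : EuclideanSpace ℝ (Fin N)) 1) ∧
      u 0 = 1 ∧ u z' = 0 ∧
      E = ∫ x in Metric.ball (0 : EuclideanSpace ℝ (Fin N)) 1, ‖g x‖ ^ p}, c ≤ E := by
    rintro E ⟨u, g, h1, h2, h3, h4, h5, h6, rfl⟩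
    exact hcm u g z' hz2.le h1 h2 h3 h4 h5 h6
  have hG0 : 0 ≤ ∫ x in Metric.ball x₀ R, ‖g x‖ ^ p := integral_nonneg fun x => by positivity
  have hmu0 : 0 ≤ muBall p z' := Real.sInf_nonneg fun E hE => hc0.le.trans (hlow E hE)
  by_cases hd : u x₀ - u z = 0
  · rw [hd, abs_zero]
    exact mul_nonneg (mul_nonneg (Real.rpow_nonneg hR.le _) (Real.rpow_nonneg hmu0 _))
      (Real.rpow_nonneg hG0 _)
  set d := u x₀ - u z with hddef
  obtain ⟨T, hT⟩ : ∃ T : EuclideanSpace ℝ (Fin N) ≃ₗᵢ[ℝ] EuclideanSpace ℝ (Fin N),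
      T z' = R⁻¹ • (z - x₀) := by
    refine ⟨(Submodule.span ℝ {z' - R⁻¹ • (z - x₀)})ᗮ.reflection, Submodule.reflection_sub ?_⟩
    rw [norm_smul, hz1, hz2, norm_inv, Real.norm_of_nonneg hR.le, inv_mul_cancel₀ hR.ne']
  have hgp : ∀ x, ‖(d⁻¹ * R) • T.symm (g (x₀ + R • T x))‖ ^ p = (R / |d|) ^ p * ‖g (x₀ + R • T x)‖ ^ p := by
    intro x
    rw [norm_smul, LinearIsometryEquiv.norm_map, Real.mul_rpow (norm_nonneg _) (norm_nonneg _)]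
    congr 2
    rw [norm_mul, norm_inv, Real.norm_of_nonneg hR.le, Real.norm_eq_abs, div_eq_mul_inv, mul_comm]
  have hin : (R / |d|) ^ p * ((R ^ N)⁻¹ * ∫ x in Metric.ball x₀ R, ‖g x‖ ^ p) ∈
     {E : ℝ | ∃ (u : EuclideanSpace ℝ (Fin N) → ℝ)
      (g : EuclideanSpace ℝ (Fin N) → EuclideanSpace ℝ (Fin N)),
      ContinuousOn u (Metric.closedBall (0 : EuclideanSpace ℝ (Fin N)) 1) ∧
      IsWeakGradOn (Metric.ball (0 : EuclideanSpace ℝ (Fin N)) 1) u g ∧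
      MeasureTheory.IntegrableOn u (Metric.ball (0 : EuclideanSpace ℝ (Fin N)) 1) ∧
      MeasureTheory.IntegrableOn (fun x => ‖g x‖ ^ p)
        (Metric.ball (0 : EuclideanSpace ℝ (Fin N)) 1) ∧
      u 0 = 1 ∧ u z' = 0 ∧
      E = ∫ x in Metric.ball (0 : EuclideanSpace ℝ (Fin N)) 1, ‖g x‖ ^ p} := by
    refine ⟨fun x => d⁻¹ * (u (x₀ + R • T x) - u z), fun x => (d⁻¹ * R) • T.symm (g (x₀ + R • T x)),
      ?_, mor_scale T x₀ R hR (u z) d⁻¹ u g hw hui, ?_, ?_, ?_, ?_, ?_⟩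
    · refine continuousOn_const.mul (ContinuousOn.sub (hc.comp ?_ ?_) continuousOn_const)
      · exact (continuous_const.add (T.continuous.const_smul R)).continuousOn
      · intro x hx
        rw [mem_closedBall_zero_iff] at hx
        rw [mem_closedBall, dist_eq_norm, add_sub_cancel_left, norm_smul, T.norm_map,
          Real.norm_of_nonneg hR.le]
        nlinarith
    · refine Integrable.const_mul (Integrable.sub (mor_cov_int T x₀ R hR u hui) ?_) _
      have : IntegrableOn (fun _ : EuclideanSpace ℝ (Fin N) => u z) (Metric.ball 0 1) := by
        rw [integrableOn_const_iff]; right; exact measure_ball_lt_top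
      exact this
    · simp_rw [hgp]
      exact Integrable.const_mul (mor_cov_int T x₀ R hR _ hgi) _
    · simp [← hddef, hd]
    · simp [hT, smul_smul, hR.ne']
    · simp_rw [hgp]
      rw [integral_const_mul, mor_cov T x₀ R hR (fun y => ‖g y‖ ^ p), smul_eq_mul]
  have hmupos : 0 < muBall p z' := hc0.trans_le (le_csInf ⟨_, hin⟩ hlow)
  have hmule : muBall p z' ≤ (R / |d|) ^ p * ((R ^ N)⁻¹ * ∫ x in Metric.ball x₀ R, ‖g x‖ ^ p) :=
    csInf_le ⟨c, fun E hE => hlow E hE⟩ hin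
  clear hin hlow hcm hgp
  generalize muBall p z' = M at *
  generalize ∫ x in Metric.ball x₀ R, ‖g x‖ ^ p = G at *
  have hdp : 0 < |d| := abs_pos.2 hd
  have h5 : M ^ (1/p) ≤ (R / |d|) * (R ^ (-((N:ℝ)/p)) * G ^ (1/p)) := by
    refine (Real.rpow_le_rpow hmu0 hmule (by positivity)).trans (le_of_eq ?_)
    rw [Real.mul_rpow (by positivity) (by positivity), ← Real.rpow_mul (by positivity),
      mul_one_div_cancel hp0.ne', Real.rpow_one, Real.mul_rpow (by positivity) hG0,
      ← Real.rpow_natCast R N, ← Real.rpow_neg hR.le, ← Real.rpow_mul hR.le]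
    congr 4; ring
  have hMp : 0 < M ^ (1/p) := by positivity
  rw [Real.rpow_neg hmu0, sub_eq_add_neg, Real.rpow_add hR, Real.rpow_one]
  rw [div_mul_eq_mul_div, le_div_iff₀ hdp] at h5
  rw [show R * R ^ (-((N:ℝ)/p)) * (M ^ (1/p))⁻¹ * G ^ (1/p) =
    (R * (R ^ (-((N:ℝ)/p)) * G ^ (1/p))) / M ^ (1/p) by ring, le_div_iff₀ hMp]
  linarith
end

section
/- Let p > N, α_p = 1 - N/p, and u ∈ C_0^∞(ℝ^N). Then for all x, y ∈ ℝ^N, |u(x) - u(y)| ≤ μ_p(B_1)^{-1/p} ‖∇u‖_{L^p(ℝ^N)} |x-y|^{α_p}, where μ_p(B_1) is the Morrey constant on the unit ball. Consequently the sharp Morrey constant 𝔪_p(ℝ^N) := inf{∫|∇u|^p : u ∈ C_0^∞(ℝ^N), [u]_{C^{0,α_p}} = 1} satisfies 𝔪_p(ℝ^N) ≥ μ_p(B_1). -/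
open Set Metric MeasureTheory

noncomputable def holderSem {N : ℕ} (α : ℝ) (S : Set (EuclideanSpace ℝ (Fin N)))
    (u : EuclideanSpace ℝ (Fin N) → ℝ) : ENNReal :=
  ⨆ x ∈ S, ⨆ y ∈ S, ENNReal.ofReal (|u x - u y| / ‖x - y‖ ^ α)

/-- The sharp Morrey constant on `ℝ^N`:
`𝔪_p(ℝ^N) = inf {∫ |∇u|^p : u ∈ C_0^∞(ℝ^N), [u]_{C^{0,α_p}} = 1}`, `α_p = 1 - N/p`. -/
noncomputable def morreyConst (N : ℕ) (p : ℝ) : ℝ :=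
  sInf {E : ℝ | ∃ u : EuclideanSpace ℝ (Fin N) → ℝ, ContDiff ℝ (⊤ : ℕ∞) u ∧
    HasCompactSupport u ∧ holderSem (1 - (N : ℝ)/p) Set.univ u = 1 ∧
    E = ∫ x : EuclideanSpace ℝ (Fin N), ‖gradient u x‖ ^ p}


theorem grad_apply {N : ℕ} (f : EuclideanSpace ℝ (Fin N) → ℝ) (x : EuclideanSpace ℝ (Fin N))
    (i : Fin N) : gradient f x i = fderiv ℝ f x (EuclideanSpace.single i 1) := by
  have h : inner ℝ (gradient f x) (EuclideanSpace.single i (1:ℝ))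
      = fderiv ℝ f x (EuclideanSpace.single i 1) := by
    rw [← toDual_gradient]
    rfl
  rw [← h, EuclideanSpace.inner_single_right]
  simp

theorem norm_grad {N : ℕ} (f : EuclideanSpace ℝ (Fin N) → ℝ) (x : EuclideanSpace ℝ (Fin N)) :
    ‖gradient f x‖ = ‖fderiv ℝ f x‖ := by
  rw [← toDual_gradient, LinearIsometryEquiv.norm_map]

theorem cont_grad {N : ℕ} {f : EuclideanSpace ℝ (Fin N) → ℝ} (hf : ContDiff ℝ (⊤ : ℕ∞) f) :
    Continuous (gradient f) := by
  have h1 : Continuous (fderiv ℝ f) := hf.continuous_fderiv (by simp)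
  exact (InnerProductSpace.toDual ℝ (EuclideanSpace ℝ (Fin N))).symm.continuous.comp h1

theorem grad_support {N : ℕ} (f : EuclideanSpace ℝ (Fin N) → ℝ) {x : EuclideanSpace ℝ (Fin N)}
    (hx : x ∉ tsupport f) : gradient f x = 0 := by
  have h : fderiv ℝ f x = 0 := by
    by_contra h
    exact hx (support_fderiv_subset ℝ h)
  rw [← norm_eq_zero, norm_grad, h, norm_zero]

theorem smooth_weak {N : ℕ} {v : EuclideanSpace ℝ (Fin N) → ℝ} (hv : ContDiff ℝ (⊤ : ℕ∞) v)
    (Ω : Set (EuclideanSpace ℝ (Fin N))) : IsWeakGradOn Ω v (gradient v) := by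
  intro φ hφ hc hs
  have hcg : HasCompactSupport (gradient φ) :=
    HasCompactSupport.of_support_subset_isCompact hc (fun x hx => by
      by_contra h; exact hx (grad_support φ h))
  rw [setIntegral_eq_integral_of_forall_compl_eq_zero, setIntegral_eq_integral_of_forall_compl_eq_zero]
  rotate_left
  · intro x hx
    rw [image_eq_zero_of_notMem_tsupport (fun h => hx (hs h)), zero_smul]
  · intro x hx
    rw [grad_support φ (fun h => hx (hs h)), smul_zero]
  have hi1 : Integrable (fun x => v x • gradient φ x) :=
    (hv.continuous.smul (cont_grad hφ)).integrable_of_hasCompactSupport hcg.smul_left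
  have hi2 : Integrable (fun x => φ x • gradient v x) :=
    (hφ.continuous.smul (cont_grad hv)).integrable_of_hasCompactSupport hc.smul_right
  ext i
  have e1 := (EuclideanSpace.proj i : EuclideanSpace ℝ (Fin N) →L[ℝ] ℝ).integral_comp_comm hi1
  have e2 := (EuclideanSpace.proj i : EuclideanSpace ℝ (Fin N) →L[ℝ] ℝ).integral_comp_comm hi2
  have hj1 := (EuclideanSpace.proj i : EuclideanSpace ℝ (Fin N) →L[ℝ] ℝ).integrable_comp hi1
  have hj2 := (EuclideanSpace.proj i : EuclideanSpace ℝ (Fin N) →L[ℝ] ℝ).integrable_comp hi2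
  simp only [PiLp.proj_apply, PiLp.smul_apply, smul_eq_mul, grad_apply] at e1 e2 hj1 hj2
  rw [PiLp.neg_apply, ← e1, ← e2]
  rw [integral_mul_fderiv_eq_neg_fderiv_mul_of_integrable]
  · simp only [mul_comm]
  · simpa only [mul_comm] using hj2
  · exact hj1
  · exact (hv.continuous.mul hφ.continuous).integrable_of_hasCompactSupport hc.mul_left
  · intro x _; exact (hv.differentiable (by simp)) x
  · intro x _; exact (hφ.differentiable (by simp)) x

def muSet {N : ℕ} (p : ℝ) (z : EuclideanSpace ℝ (Fin N)) : Set ℝ :=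
  {E : ℝ | ∃ (u : EuclideanSpace ℝ (Fin N) → ℝ)
      (g : EuclideanSpace ℝ (Fin N) → EuclideanSpace ℝ (Fin N)),
    ContinuousOn u (Metric.closedBall (0 : EuclideanSpace ℝ (Fin N)) 1) ∧
    IsWeakGradOn (Metric.ball (0 : EuclideanSpace ℝ (Fin N)) 1) u g ∧
    MeasureTheory.IntegrableOn u (Metric.ball (0 : EuclideanSpace ℝ (Fin N)) 1) ∧
    MeasureTheory.IntegrableOn (fun x => ‖g x‖ ^ p)
      (Metric.ball (0 : EuclideanSpace ℝ (Fin N)) 1) ∧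
    u 0 = 1 ∧ u z = 0 ∧
    E = ∫ x in Metric.ball (0 : EuclideanSpace ℝ (Fin N)) 1, ‖g x‖ ^ p}

theorem muBall_eq {N : ℕ} (p : ℝ) (z : EuclideanSpace ℝ (Fin N)) :
    muBall p z = sInf (muSet p z) := rfl

theorem contOn_ball_int {N : ℕ} {F : Type*} [NormedAddCommGroup F]
    {f : EuclideanSpace ℝ (Fin N) → F}
    (hf : ContinuousOn f (closedBall 0 1)) : IntegrableOn f (ball 0 1) :=
  (hf.integrableOn_compact (isCompact_closedBall _ _)).mono_set ball_subset_closedBall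

theorem smooth_mem {N : ℕ} {p : ℝ} (hp : 0 < p) {z : EuclideanSpace ℝ (Fin N)}
    {v : EuclideanSpace ℝ (Fin N) → ℝ} (hv : ContDiff ℝ (⊤ : ℕ∞) v) (h0 : v 0 = 1) (hz : v z = 0) :
    (∫ x in Metric.ball (0 : EuclideanSpace ℝ (Fin N)) 1, ‖gradient v x‖ ^ p) ∈ muSet p z := by
  refine ⟨v, gradient v, hv.continuous.continuousOn, smooth_weak hv _,
    contOn_ball_int hv.continuous.continuousOn, contOn_ball_int ?_, h0, hz, rfl⟩
  exact ((cont_grad hv).norm.rpow_const (fun _ => Or.inr hp.le)).continuousOn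

theorem muSet_nonempty {N : ℕ} {p : ℝ} (hp : 0 < p) {z : EuclideanSpace ℝ (Fin N)}
    (hz : ‖z‖ = 1) : (muSet p z).Nonempty := by
  refine ⟨_, smooth_mem hp (v := fun x => 1 - inner ℝ z x) ?_ ?_ ?_⟩
  · exact contDiff_const.sub (contDiff_const.inner ℝ contDiff_id)
  · simp
  · simp [hz]

theorem muSet_nonneg {N : ℕ} {p : ℝ} {z : EuclideanSpace ℝ (Fin N)} :
    ∀ E ∈ muSet p z, 0 ≤ E := by
  rintro E ⟨u, g, -, -, -, -, -, -, rfl⟩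
  exact integral_nonneg (fun x => by positivity)

theorem core {N : ℕ} {p : ℝ} (hp : 0 < p) {z : EuclideanSpace ℝ (Fin N)}
    (hz : ‖z‖ = 1) {u : EuclideanSpace ℝ (Fin N) → ℝ} (hu : ContDiff ℝ (⊤ : ℕ∞) u)
    (hc : HasCompactSupport u) {x y : EuclideanSpace ℝ (Fin N)} (hxy : u x ≠ u y) :
    muBall p z * |u x - u y| ^ p ≤
      ‖x - y‖ ^ (p - N) * ∫ w, ‖gradient u w‖ ^ p := by
  have hne : x ≠ y := fun h => hxy (by rw [h])
  set r := ‖x - y‖ with hr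
  have hr0 : 0 < r := by rw [hr, norm_pos_iff, sub_ne_zero]; exact hne
  set d := u x - u y with hd
  have hd0 : d ≠ 0 := sub_ne_zero.2 hxy
  have hn : ‖z‖ = ‖r⁻¹ • (y - x)‖ := by
    rw [norm_smul, norm_sub_rev y x, ← hr, hz, norm_inv, Real.norm_of_nonneg hr0.le,
      inv_mul_cancel₀ hr0.ne']
  set R : EuclideanSpace ℝ (Fin N) ≃ₗᵢ[ℝ] EuclideanSpace ℝ (Fin N) :=
    (Submodule.span ℝ {z - r⁻¹ • (y - x)})ᗮ.reflection with hR
  have hRz : R z = r⁻¹ • (y - x) := Submodule.reflection_sub hn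
  set v : EuclideanSpace ℝ (Fin N) → ℝ := fun w => d⁻¹ * (u (x + r • R w) - u y) with hvdef
  have hA : ContDiff ℝ (⊤ : ℕ∞) (fun w => x + r • R w) :=
    contDiff_const.add (R.contDiff.const_smul r)
  have hv : ContDiff ℝ (⊤ : ℕ∞) v := contDiff_const.mul ((hu.comp hA).sub contDiff_const)
  have hv0 : v 0 = 1 := by simp [hvdef, ← hd, hd0]
  have hvz : v z = 0 := by simp [hvdef, hRz, smul_smul, hr0.ne']
  have hgrad : ∀ w, ‖gradient v w‖ = |d|⁻¹ * r * ‖gradient u (x + r • R w)‖ := by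
    intro w
    rw [norm_grad, norm_grad]
    have h1 : HasFDerivAt (fun w => x + r • R w)
        (r • (R : EuclideanSpace ℝ (Fin N) →L[ℝ] EuclideanSpace ℝ (Fin N))) w :=
      ((R : EuclideanSpace ℝ (Fin N) →L[ℝ] EuclideanSpace ℝ (Fin N)).hasFDerivAt.const_smul r).const_add x
    have h2 : HasFDerivAt u (fderiv ℝ u (x + r • R w)) (x + r • R w) :=
      (hu.differentiable (by simp) _).hasFDerivAt
    have h3 := ((h2.comp w h1).sub_const (u y)).const_mul d⁻¹
    have h4 := h3.fderiv
    have h5 : fderiv ℝ v w = d⁻¹ • (fderiv ℝ u (x + r • R w)).comp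
        (r • (R : EuclideanSpace ℝ (Fin N) →L[ℝ] EuclideanSpace ℝ (Fin N))) := h4
    rw [h5, ContinuousLinearMap.comp_smul, smul_smul, norm_smul]
    have h6 : ‖(fderiv ℝ u (x + r • R w)).comp
        (R : EuclideanSpace ℝ (Fin N) →L[ℝ] EuclideanSpace ℝ (Fin N))‖ =
        ‖fderiv ℝ u (x + r • R w)‖ :=
      ContinuousLinearMap.opNorm_comp_linearIsometryEquiv _ R
    rw [h6, norm_mul, norm_inv, Real.norm_eq_abs, Real.norm_of_nonneg hr0.le]
  have hcgu : HasCompactSupport (gradient u) :=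
    HasCompactSupport.of_support_subset_isCompact hc (fun x hx => by
      by_contra h; exact hx (grad_support u h))
  set G : EuclideanSpace ℝ (Fin N) → ℝ := fun w => ‖gradient u w‖ ^ p with hG
  have hGi : Integrable G :=
    ((cont_grad hu).norm.rpow_const (fun _ => Or.inr hp.le)).integrable_of_hasCompactSupport
      (hcgu.comp_left (g := fun w : EuclideanSpace ℝ (Fin N) => ‖w‖ ^ p)
        (by simp [Real.zero_rpow hp.ne']))
  have hGr : Integrable (fun w => G (x + r • w)) :=
    Integrable.comp_smul (hGi.comp_add_left x) hr0.ne'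
  have hRm : MeasurePreserving R := R.measurePreserving
  have hGR : Integrable (fun w => G (x + r • R w)) :=
    hRm.integrable_comp_of_integrable hGr
  have hint : ∫ w, G (x + r • R w) = (r ^ N)⁻¹ * ∫ w, G w := by
    rw [hRm.integral_comp R.toHomeomorph.measurableEmbedding (fun w => G (x + r • w))]
    rw [Measure.integral_comp_smul volume (fun w => G (x + w)) r, integral_add_left_eq_self]
    rw [abs_of_pos (by positivity)]
    simp
  have hE : ∀ w, ‖gradient v w‖ ^ p = (|d|⁻¹ * r) ^ p * G (x + r • R w) := by
    intro w
    rw [hgrad, Real.mul_rpow (by positivity) (by positivity)]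
  have hle : muBall p z ≤ (|d|⁻¹ * r) ^ p * ((r ^ N)⁻¹ * ∫ w, G w) := by
    calc muBall p z ≤ ∫ w in ball (0 : EuclideanSpace ℝ (Fin N)) 1, ‖gradient v w‖ ^ p :=
          csInf_le ⟨0, muSet_nonneg⟩ (smooth_mem hp hv hv0 hvz)
      _ ≤ ∫ w, ‖gradient v w‖ ^ p := by
          refine setIntegral_le_integral ?_ (ae_of_all _ fun w => by positivity)
          simp only [hE]
          exact hGR.const_mul _
      _ = _ := by simp only [hE]; rw [integral_const_mul, hint]
  have hd' : 0 < |d| := abs_pos.2 hd0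
  calc muBall p z * |d| ^ p ≤ ((|d|⁻¹ * r) ^ p * ((r ^ N)⁻¹ * ∫ w, G w)) * |d| ^ p := by gcongr
    _ = _ := by
      rw [Real.mul_rpow (by positivity) hr0.le, Real.inv_rpow hd'.le, Real.rpow_sub hr0,
        Real.rpow_natCast]
      have : |d| ^ p ≠ 0 := by positivity
      field_simp

noncomputable def ps {N : ℕ} (η : EuclideanSpace ℝ (Fin N) → ℝ) (ζ : EuclideanSpace ℝ (Fin N))
    (t : ℝ) (x : EuclideanSpace ℝ (Fin N)) : ℝ := (t ^ N)⁻¹ * η (t⁻¹ • (x - ζ) + ζ)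

noncomputable def dps {N : ℕ} (η : EuclideanSpace ℝ (Fin N) → ℝ) (ζ : EuclideanSpace ℝ (Fin N))
    (t : ℝ) (x : EuclideanSpace ℝ (Fin N)) : ℝ :=
  -(N * t⁻¹ * ps η ζ t x
    + (t ^ N)⁻¹ * fderiv ℝ η (t⁻¹ • (x - ζ) + ζ) ((t ^ 2)⁻¹ • (x - ζ)))

noncomputable def phi {N : ℕ} (η : EuclideanSpace ℝ (Fin N) → ℝ) (ζ : EuclideanSpace ℝ (Fin N))
    (t : ℝ) (i : Fin N) (x : EuclideanSpace ℝ (Fin N)) : ℝ :=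
  t⁻¹ * (x i - ζ i) * ps η ζ t x

theorem ps_contDiff {N : ℕ} {η : EuclideanSpace ℝ (Fin N) → ℝ} (hη : ContDiff ℝ (⊤ : ℕ∞) η)
    (ζ : EuclideanSpace ℝ (Fin N)) (t : ℝ) : ContDiff ℝ (⊤ : ℕ∞) (ps η ζ t) := by
  have h : ContDiff ℝ (⊤ : ℕ∞) (fun x : EuclideanSpace ℝ (Fin N) => t⁻¹ • (x - ζ) + ζ) :=
    ((contDiff_id.sub contDiff_const).const_smul t⁻¹).add contDiff_const
  exact contDiff_const.mul (hη.comp h)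

theorem phi_contDiff {N : ℕ} {η : EuclideanSpace ℝ (Fin N) → ℝ} (hη : ContDiff ℝ (⊤ : ℕ∞) η)
    (ζ : EuclideanSpace ℝ (Fin N)) (t : ℝ) (i : Fin N) : ContDiff ℝ (⊤ : ℕ∞) (phi η ζ t i) := by
  have h : ContDiff ℝ (⊤ : ℕ∞) (fun x : EuclideanSpace ℝ (Fin N) => x i) :=
    (EuclideanSpace.proj i : EuclideanSpace ℝ (Fin N) →L[ℝ] ℝ).contDiff
  exact (contDiff_const.mul (h.sub contDiff_const)).mul (ps_contDiff hη ζ t)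

theorem ps_ne {N : ℕ} {η : EuclideanSpace ℝ (Fin N) → ℝ} (hs : ∀ y, 1/2 < ‖y‖ → η y = 0)
    {ζ : EuclideanSpace ℝ (Fin N)} (hζ : ‖ζ‖ ≤ 1) {t : ℝ} (ht : 0 < t)
    {x : EuclideanSpace ℝ (Fin N)} (hx : ps η ζ t x ≠ 0) :
    ‖t⁻¹ • (x - ζ)‖ ≤ 2 ∧ ‖x - ζ‖ ≤ 2 * t ∧ (t ≤ 1 → ‖x‖ ≤ 1 - t/2) := by
  have h1 : ‖t⁻¹ • (x - ζ) + ζ‖ ≤ 1/2 := by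
    by_contra h
    exact hx (by simp [ps, hs _ (not_le.1 h)])
  set y := t⁻¹ • (x - ζ) + ζ with hy
  have h2 : t⁻¹ • (x - ζ) = y - ζ := by rw [hy]; abel
  have h3 : x - ζ = t • (y - ζ) := by rw [← h2, smul_smul, mul_inv_cancel₀ ht.ne', one_smul]
  have h4 : ‖y - ζ‖ ≤ 2 := (norm_sub_le _ _).trans (by linarith)
  refine ⟨h2 ▸ h4, ?_, fun ht1 => ?_⟩
  · rw [h3, norm_smul, Real.norm_of_nonneg ht.le]; nlinarith
  · have h5 : x = t • y + (1 - t) • ζ := by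
      rw [← sub_add_cancel x ζ, h3]; module
    rw [h5]
    refine (norm_add_le _ _).trans ?_
    rw [norm_smul, norm_smul, Real.norm_of_nonneg ht.le, Real.norm_of_nonneg (by linarith)]
    nlinarith

theorem ps_integral {N : ℕ} {η : EuclideanSpace ℝ (Fin N) → ℝ} (h1 : ∫ x, η x = 1)
    (ζ : EuclideanSpace ℝ (Fin N)) {t : ℝ} (ht : 0 < t) : ∫ x, ps η ζ t x = 1 := by
  unfold ps
  rw [integral_const_mul, integral_sub_right_eq_self (fun x => η (t⁻¹ • x + ζ)) ζ,
    Measure.integral_comp_inv_smul volume (fun x => η (x + ζ)) t, integral_add_right_eq_self, h1,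
    abs_of_pos (by positivity)]
  have : t ^ N ≠ 0 := by positivity
  simp [this]

theorem ps_setIntegral {N : ℕ} {η : EuclideanSpace ℝ (Fin N) → ℝ} (h1 : ∫ x, η x = 1)
    (hs : ∀ y, 1/2 < ‖y‖ → η y = 0)
    {ζ : EuclideanSpace ℝ (Fin N)} (hζ : ‖ζ‖ ≤ 1) {t : ℝ} (ht : 0 < t) (ht1 : t ≤ 1) :
    ∫ x in ball 0 1, ps η ζ t x = 1 := by
  rw [setIntegral_eq_integral_of_forall_compl_eq_zero, ps_integral h1 ζ ht]
  intro x hx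
  by_contra h
  have := (ps_ne hs hζ ht h).2.2 ht1
  simp at hx
  linarith

theorem phi_tsupport {N : ℕ} {η : EuclideanSpace ℝ (Fin N) → ℝ} (hs : ∀ y, 1/2 < ‖y‖ → η y = 0)
    {ζ : EuclideanSpace ℝ (Fin N)} (hζ : ‖ζ‖ ≤ 1) {t : ℝ} (ht : 0 < t) (ht1 : t ≤ 1) (i : Fin N) :
    tsupport (phi η ζ t i) ⊆ closedBall 0 (1 - t/2) := by
  refine closure_minimal ?_ isClosed_closedBall
  intro x hx
  have h : ps η ζ t x ≠ 0 := fun h => hx (by simp [phi, h])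
  simpa using (ps_ne hs hζ ht h).2.2 ht1

theorem phi_abs {N : ℕ} {η : EuclideanSpace ℝ (Fin N) → ℝ} (hs : ∀ y, 1/2 < ‖y‖ → η y = 0)
    (h0 : ∀ y, 0 ≤ η y)
    {ζ : EuclideanSpace ℝ (Fin N)} (hζ : ‖ζ‖ ≤ 1) {t : ℝ} (ht : 0 < t) (i : Fin N)
    (x : EuclideanSpace ℝ (Fin N)) : |phi η ζ t i x| ≤ 2 * ps η ζ t x := by
  by_cases h : ps η ζ t x = 0
  · simp [phi, h]
  have h2 := (ps_ne hs hζ ht h).1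
  have h3 : |t⁻¹ * (x i - ζ i)| ≤ 2 := by
    have := PiLp.norm_apply_le (t⁻¹ • (x - ζ)) i
    refine le_trans ?_ h2
    simpa using this
  have h4 : 0 ≤ ps η ζ t x := mul_nonneg (by positivity) (h0 _)
  unfold phi
  rw [abs_mul, abs_of_nonneg h4]
  gcongr

theorem ps_hasDerivAt {N : ℕ} {η : EuclideanSpace ℝ (Fin N) → ℝ} (hη : ContDiff ℝ (⊤ : ℕ∞) η)
    (ζ : EuclideanSpace ℝ (Fin N)) {t : ℝ} (ht : 0 < t) (x : EuclideanSpace ℝ (Fin N)) :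
    HasDerivAt (fun s => ps η ζ s x) (dps η ζ t x) t := by
  have h1 : HasDerivAt (fun s : ℝ => s⁻¹ • (x - ζ) + ζ) ((-(t ^ 2)⁻¹) • (x - ζ)) t :=
    ((hasDerivAt_inv ht.ne').smul_const (x - ζ)).add_const ζ
  have h2 : HasFDerivAt η (fderiv ℝ η (t⁻¹ • (x - ζ) + ζ)) (t⁻¹ • (x - ζ) + ζ) :=
    (hη.differentiable (by simp) _).hasFDerivAt
  have h3 := h2.comp_hasDerivAt t h1
  have h4 : HasDerivAt (fun s : ℝ => (s ^ N)⁻¹) (-(N * t ^ (N - 1)) / (t ^ N) ^ 2) t :=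
    (hasDerivAt_pow N t).inv (by positivity)
  have h5 := h4.mul h3
  have h6 : -(N * t ^ (N - 1)) / (t ^ N) ^ 2 = -(N * t⁻¹ * (t ^ N)⁻¹) := by
    rcases N with _ | n
    · simp
    · simp only [Nat.add_sub_cancel]
      field_simp
      ring
  refine h5.congr_deriv ?_
  rw [h6]
  simp only [dps, ps, Function.comp, map_smul, smul_eq_mul]
  ring

theorem sum_basis {N : ℕ} (L : EuclideanSpace ℝ (Fin N) →L[ℝ] ℝ) (v : EuclideanSpace ℝ (Fin N)) :
    ∑ i, v i • L (EuclideanSpace.single i 1) = L v := by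
  have : ∑ i, v i • EuclideanSpace.single i (1:ℝ) = v := by
    ext j
    simp [Pi.single_apply]
  conv_rhs => rw [← this]
  rw [map_sum]
  simp only [map_smul]

theorem phi_div {N : ℕ} {η : EuclideanSpace ℝ (Fin N) → ℝ} (hη : ContDiff ℝ (⊤ : ℕ∞) η)
    (ζ : EuclideanSpace ℝ (Fin N)) {t : ℝ} (ht : 0 < t) (x : EuclideanSpace ℝ (Fin N)) :
    ∑ i, gradient (phi η ζ t i) x i = - dps η ζ t x := by
  have key : ∀ i, gradient (phi η ζ t i) x i = t⁻¹ * ps η ζ t x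
      + (t⁻¹ * (t ^ N)⁻¹ * t⁻¹) *
        ((x - ζ) i • fderiv ℝ η (t⁻¹ • (x - ζ) + ζ) (EuclideanSpace.single i 1)) := by
    intro i
    rw [grad_apply]
    have h1 : HasFDerivAt (fun x : EuclideanSpace ℝ (Fin N) => t⁻¹ * (x i - ζ i))
        (t⁻¹ • (EuclideanSpace.proj i : EuclideanSpace ℝ (Fin N) →L[ℝ] ℝ)) x :=
      (((EuclideanSpace.proj i : EuclideanSpace ℝ (Fin N) →L[ℝ] ℝ).hasFDerivAt).sub_const
        (ζ i)).const_mul t⁻¹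
    have h2 : HasFDerivAt (fun x : EuclideanSpace ℝ (Fin N) => t⁻¹ • (x - ζ) + ζ)
        (t⁻¹ • ContinuousLinearMap.id ℝ (EuclideanSpace ℝ (Fin N))) x :=
      (((hasFDerivAt_id x).sub_const ζ).const_smul t⁻¹).add_const ζ
    have h3 : HasFDerivAt η (fderiv ℝ η (t⁻¹ • (x - ζ) + ζ)) (t⁻¹ • (x - ζ) + ζ) :=
      (hη.differentiable (by simp) _).hasFDerivAt
    have h4 : HasFDerivAt (ps η ζ t) _ x := (h3.comp x h2).const_mul (t ^ N)⁻¹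
    have h5 : HasFDerivAt (phi η ζ t i) _ x := h1.mul h4
    rw [h5.fderiv]
    simp
    ring
  rw [Finset.sum_congr rfl (fun i _ => key i), Finset.sum_add_distrib, ← Finset.mul_sum, ← Finset.mul_sum]
  have hsum := sum_basis (fderiv ℝ η (t⁻¹ • (x - ζ) + ζ)) (x - ζ)
  rw [hsum]
  simp only [dps, map_smul, smul_eq_mul, Finset.sum_const, Finset.card_univ, Fintype.card_fin,
    nsmul_eq_mul]
  ring

theorem f_deriv {N : ℕ} {η : EuclideanSpace ℝ (Fin N) → ℝ} (hη : ContDiff ℝ (⊤ : ℕ∞) η)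
    {M M' : ℝ} (hM : ∀ y, |η y| ≤ M) (hM' : ∀ y, ‖fderiv ℝ η y‖ ≤ M')
    {ζ : EuclideanSpace ℝ (Fin N)} (hζ : ‖ζ‖ ≤ 1)
    {u : EuclideanSpace ℝ (Fin N) → ℝ} (hu : ContinuousOn u (closedBall 0 1))
    {t : ℝ} (ht : 0 < t) :
    HasDerivAt (fun s => ∫ x in ball 0 1, u x * ps η ζ s x)
      (∫ x in ball 0 1, u x * dps η ζ t x) t := by
  obtain ⟨U, hU⟩ := (isCompact_closedBall (0 : EuclideanSpace ℝ (Fin N)) 1).exists_bound_of_continuousOn hu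
  have hui := contOn_ball_int hu
  have hpsc : ∀ s, Continuous (ps η ζ s) := fun s => (ps_contDiff hη ζ s).continuous
  have hdc : Continuous (dps η ζ t) := by
    have h1 : Continuous (fderiv ℝ η) := hη.continuous_fderiv (by simp)
    have h2 : Continuous (fun x : EuclideanSpace ℝ (Fin N) => t⁻¹ • (x - ζ) + ζ) := by fun_prop
    have h3 : Continuous (fun x : EuclideanSpace ℝ (Fin N) => (t ^ 2)⁻¹ • (x - ζ)) := by fun_prop
    exact ((continuous_const.mul (hpsc t)).add
      (continuous_const.mul ((h1.comp h2).clm_apply h3))).neg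
  have hM0 : 0 ≤ M := (abs_nonneg _).trans (hM 0)
  have hM0' : 0 ≤ M' := (norm_nonneg _).trans (hM' 0)
  refine (hasDerivAt_integral_of_dominated_loc_of_deriv_le (𝕜 := ℝ) (E := ℝ) (s := Ioi (t/2))
    (F := fun s x => u x * ps η ζ s x) (F' := fun s x => u x * dps η ζ s x)
    (bound := fun _ => U * (N * (t/2)⁻¹ * (((t/2) ^ N)⁻¹ * M)
      + ((t/2) ^ N)⁻¹ * (M' * (((t/2) ^ 2)⁻¹ * 2))))
    (Ioi_mem_nhds (half_lt_self ht)) ?_ ?_ ?_ ?_ ?_ ?_).2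
  · exact Filter.Eventually.of_forall fun s =>
      (hui.aestronglyMeasurable).mul (hpsc s).aestronglyMeasurable
  · exact contOn_ball_int (hu.mul (hpsc t).continuousOn)
  · exact (hui.aestronglyMeasurable).mul hdc.aestronglyMeasurable
  · refine (ae_restrict_iff' measurableSet_ball).2 (ae_of_all _ fun x hx s hs => ?_)
    have hx1 : ‖x‖ < 1 := by simpa using hx
    have hs' : t/2 < s := hs
    have ht2 : 0 < t/2 := by linarith
    have hs0 : 0 < s := by linarith
    have hxz : ‖x - ζ‖ ≤ 2 := (norm_sub_le _ _).trans (by linarith)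
    rw [norm_mul]
    have hU0 : 0 ≤ U := (norm_nonneg _).trans (hU x (ball_subset_closedBall hx))
    refine mul_le_mul (hU x (ball_subset_closedBall hx)) ?_ (norm_nonneg _) hU0
    unfold dps
    rw [norm_neg]
    refine (norm_add_le _ _).trans ?_
    have e1 : ‖ps η ζ s x‖ ≤ ((t/2) ^ N)⁻¹ * M := by
      unfold ps
      rw [norm_mul, Real.norm_of_nonneg (by positivity : 0 ≤ (s ^ N)⁻¹)]
      gcongr
      exact hM _
    have e2 : ‖fderiv ℝ η (s⁻¹ • (x - ζ) + ζ) ((s ^ 2)⁻¹ • (x - ζ))‖ ≤ M' * (((t/2) ^ 2)⁻¹ * 2) := by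
      refine (ContinuousLinearMap.le_opNorm _ _).trans ?_
      refine mul_le_mul (hM' _) ?_ (norm_nonneg _) hM0'
      rw [norm_smul, Real.norm_of_nonneg (by positivity : 0 ≤ (s ^ 2)⁻¹)]
      gcongr
    rw [norm_mul, norm_mul ((s ^ N)⁻¹), Real.norm_of_nonneg (by positivity : 0 ≤ (s ^ N)⁻¹),
      Real.norm_of_nonneg (by positivity : 0 ≤ (N : ℝ) * s⁻¹)]
    gcongr
  · exact integrableOn_const measure_ball_lt_top.ne
  · exact ae_of_all _ fun x s hs =>
      (ps_hasDerivAt hη ζ (lt_trans (half_pos ht) (show t/2 < s from hs)) x).const_mul (u x)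

theorem holder_step {N : ℕ} {η : EuclideanSpace ℝ (Fin N) → ℝ} (hη : ContDiff ℝ (⊤ : ℕ∞) η)
    {M : ℝ} (hM : ∀ y, |η y| ≤ M) (h1 : ∫ x, η x = 1)
    (hs : ∀ y, 1/2 < ‖y‖ → η y = 0) (h0 : ∀ y, 0 ≤ η y) {p : ℝ} (hp : 1 < p)
    {ζ : EuclideanSpace ℝ (Fin N)} (hζ : ‖ζ‖ ≤ 1)
    {g : EuclideanSpace ℝ (Fin N) → EuclideanSpace ℝ (Fin N)}
    (hg : IntegrableOn (fun x => ‖g x‖ ^ p) (ball 0 1))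
    {t : ℝ} (ht : 0 < t) (ht1 : t ≤ 1) :
    IntegrableOn (fun x => ‖g x‖ * ps η ζ t x) (ball 0 1) ∧
    ∫ x in ball 0 1, ‖g x‖ * ps η ζ t x ≤
      (∫ x in ball 0 1, ‖g x‖ ^ p) ^ (1/p) * (M ^ (1/p) * t ^ (-((N : ℝ)/p))) := by
  have hp0 : 0 < p := by linarith
  set q := p.conjExponent with hq
  have hpq : p.HolderConjugate q := Real.HolderConjugate.conjExponent hp
  have hq1 : 1 < q := hpq.symm.lt
  have hM0 : 0 ≤ M := (abs_nonneg _).trans (hM 0)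
  have hpsc : Continuous (ps η ζ t) := (ps_contDiff hη ζ t).continuous
  have hps0 : ∀ x, 0 ≤ ps η ζ t x := fun x => mul_nonneg (by positivity) (h0 _)
  have hpsM : ∀ x, ps η ζ t x ≤ (t ^ N)⁻¹ * M := fun x => by
    unfold ps; gcongr; exact (le_abs_self _).trans (hM _)
  have hgm : AEStronglyMeasurable (fun x => ‖g x‖) (volume.restrict (ball 0 1)) := by
    have h2 := (hg.aestronglyMeasurable.aemeasurable.pow_const (1/p)).aestronglyMeasurable
    refine h2.congr (ae_of_all _ fun x => ?_)
    simp only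
    rw [← Real.rpow_mul (norm_nonneg _), mul_one_div_cancel hp0.ne', Real.rpow_one]
  have hfin : IsFiniteMeasure (volume.restrict (ball (0 : EuclideanSpace ℝ (Fin N)) 1)) :=
    ⟨by simpa using measure_ball_lt_top⟩
  have hgL : MemLp (fun x => ‖g x‖) (ENNReal.ofReal p) (volume.restrict (ball 0 1)) := by
    rw [← integrable_norm_rpow_iff hgm (by simpa using hp0) (by simp)]
    rw [ENNReal.toReal_ofReal hp0.le]
    simp only [norm_norm]
    exact hg
  have hpL : MemLp (ps η ζ t) (ENNReal.ofReal q) (volume.restrict (ball 0 1)) := by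
    refine MemLp.of_bound hpsc.aestronglyMeasurable ((t ^ N)⁻¹ * M) (ae_of_all _ fun x => ?_)
    rw [Real.norm_of_nonneg (hps0 x)]; exact hpsM x
  have hg1 : IntegrableOn (fun x => ‖g x‖) (ball 0 1) :=
    hgL.integrable (by rw [ENNReal.one_le_ofReal]; exact hp.le)
  refine ⟨?_, ?_⟩
  · refine Integrable.mul_bdd (c := (t ^ N)⁻¹ * M) hg1 hpsc.aestronglyMeasurable (ae_of_all _ fun x => ?_)
    rw [Real.norm_of_nonneg (hps0 x)]; exact hpsM x
  refine (integral_mul_le_Lp_mul_Lq_of_nonneg hpq (ae_of_all _ fun x => norm_nonneg _)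
    (ae_of_all _ hps0) hgL hpL).trans ?_
  refine mul_le_mul_of_nonneg_left ?_ (by positivity)
  have hpi : IntegrableOn (ps η ζ t) (ball 0 1) := contOn_ball_int hpsc.continuousOn
  have h3 : ∫ x in ball 0 1, ps η ζ t x ^ q ≤ ((t ^ N)⁻¹ * M) ^ (q - 1) := by
    calc ∫ x in ball 0 1, ps η ζ t x ^ q
        ≤ ∫ x in ball 0 1, ((t ^ N)⁻¹ * M) ^ (q - 1) * ps η ζ t x := by
          refine integral_mono_of_nonneg (ae_of_all _ fun x => Real.rpow_nonneg (hps0 x) _)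
            (hpi.const_mul _) (ae_of_all _ fun x => ?_)
          simp only
          have : ps η ζ t x ^ q = ps η ζ t x ^ (q - 1) * ps η ζ t x := by
            rw [← Real.rpow_add_one' (hps0 x) (by linarith)]; ring_nf
          rw [this]
          exact mul_le_mul_of_nonneg_right
            (Real.rpow_le_rpow (hps0 x) (hpsM x) (by linarith)) (hps0 x)
      _ = _ := by rw [integral_const_mul, ps_setIntegral h1 hs hζ ht ht1, mul_one]
  have hq0 : 0 < q := by linarith
  have hexp : (q - 1) * (1/q) = 1/p := by
    have := hpq.inv_add_inv_eq_one
    field_simp at this ⊢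
    linarith
  calc (∫ x in ball 0 1, ps η ζ t x ^ q) ^ (1/q) ≤ (((t ^ N)⁻¹ * M) ^ (q - 1)) ^ (1/q) := by
        refine Real.rpow_le_rpow (integral_nonneg fun x => Real.rpow_nonneg (hps0 x) _) h3 (by positivity)
    _ = _ := by
        rw [← Real.rpow_mul (by positivity), hexp, Real.mul_rpow (by positivity) hM0, mul_comm]
        congr 1
        rw [← Real.rpow_natCast, ← Real.rpow_neg ht.le, ← Real.rpow_mul ht.le]
        congr 1; ring

theorem deriv_bound {N : ℕ} {η : EuclideanSpace ℝ (Fin N) → ℝ} (hη : ContDiff ℝ (⊤ : ℕ∞) η)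
    {M : ℝ} (hM : ∀ y, |η y| ≤ M) (h1 : ∫ x, η x = 1)
    (hs : ∀ y, 1/2 < ‖y‖ → η y = 0) (h0 : ∀ y, 0 ≤ η y) {p : ℝ} (hp : 1 < p)
    {ζ : EuclideanSpace ℝ (Fin N)} (hζ : ‖ζ‖ ≤ 1)
    {u : EuclideanSpace ℝ (Fin N) → ℝ} (hu : ContinuousOn u (closedBall 0 1))
    {g : EuclideanSpace ℝ (Fin N) → EuclideanSpace ℝ (Fin N)}
    (hw : IsWeakGradOn (ball 0 1) u g)
    (hg : IntegrableOn (fun x => ‖g x‖ ^ p) (ball 0 1))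
    {t : ℝ} (ht : 0 < t) (ht1 : t ≤ 1) :
    |∫ x in ball 0 1, u x * dps η ζ t x| ≤
      N * (2 * ((∫ x in ball 0 1, ‖g x‖ ^ p) ^ (1/p) * (M ^ (1/p) * t ^ (-((N : ℝ)/p))))) := by
  obtain ⟨hi, hh⟩ := holder_step hη hM h1 hs h0 hp hζ hg ht ht1
  have hint : ∀ i, IntegrableOn (fun x => u x • gradient (phi η ζ t i) x) (ball 0 1) := fun i =>
    contOn_ball_int (hu.smul (cont_grad (phi_contDiff hη ζ t i)).continuousOn)
  have hcomp : ∀ i, ∫ x in ball 0 1, u x * gradient (phi η ζ t i) x i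
      = (∫ x in ball 0 1, u x • gradient (phi η ζ t i) x) i := fun i => by
    have e1 := (EuclideanSpace.proj i : EuclideanSpace ℝ (Fin N) →L[ℝ] ℝ).integral_comp_comm (hint i)
    simpa only [PiLp.proj_apply, PiLp.smul_apply, smul_eq_mul] using e1
  have hinti : ∀ i, IntegrableOn (fun x => u x * gradient (phi η ζ t i) x i) (ball 0 1) := fun i => by
    have e1 := (EuclideanSpace.proj i : EuclideanSpace ℝ (Fin N) →L[ℝ] ℝ).integrable_comp (hint i)
    simp only [PiLp.proj_apply, PiLp.smul_apply, smul_eq_mul] at e1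
    exact e1
  have hsum : ∫ x in ball 0 1, u x * dps η ζ t x =
      - ∑ i, (∫ x in ball 0 1, u x • gradient (phi η ζ t i) x) i := by
    simp only [← hcomp]
    rw [← integral_finsetSum _ (fun i _ => hinti i), ← integral_neg]
    congr 1; ext x
    rw [← Finset.mul_sum, phi_div hη ζ ht]; ring
  rw [hsum, abs_neg]
  refine (Finset.abs_sum_le_sum_abs _ _).trans ?_
  refine (Finset.sum_le_card_nsmul _ _
    (2 * ((∫ x in ball 0 1, ‖g x‖ ^ p) ^ (1/p) * (M ^ (1/p) * t ^ (-((N : ℝ)/p))))) ?_).trans (by simp)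
  intro i _
  have hsup := phi_tsupport hs hζ ht ht1 i
  have hsup1 : tsupport (phi η ζ t i) ⊆ ball 0 1 :=
    hsup.trans (closedBall_subset_ball (by linarith))
  have hcs : HasCompactSupport (phi η ζ t i) :=
    (isCompact_closedBall _ _).of_isClosed_subset (isClosed_tsupport _) hsup
  have hweak := hw _ (phi_contDiff hη ζ t i) hcs hsup1
  have hn := PiLp.norm_apply_le (∫ x in ball 0 1, u x • gradient (phi η ζ t i) x) i
  refine (show |_| ≤ _ from hn).trans ?_
  rw [hweak, norm_neg]
  refine (norm_integral_le_integral_norm _).trans ?_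
  calc ∫ x in ball 0 1, ‖phi η ζ t i x • g x‖
      ≤ ∫ x in ball 0 1, 2 * (‖g x‖ * ps η ζ t x) := by
        refine integral_mono_of_nonneg (ae_of_all _ fun x => norm_nonneg _)
          (hi.const_mul 2) (ae_of_all _ fun x => ?_)
        simp only
        rw [norm_smul]
        have := phi_abs hs h0 hζ ht i x
        calc ‖phi η ζ t i x‖ * ‖g x‖ ≤ (2 * ps η ζ t x) * ‖g x‖ :=
              mul_le_mul_of_nonneg_right this (norm_nonneg _)
          _ = _ := by ring
    _ ≤ _ := by rw [integral_const_mul]; gcongr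

theorem f_limit {N : ℕ} {η : EuclideanSpace ℝ (Fin N) → ℝ} (hη : ContDiff ℝ (⊤ : ℕ∞) η)
    (h1 : ∫ x, η x = 1)
    (hs : ∀ y, 1/2 < ‖y‖ → η y = 0) (h0 : ∀ y, 0 ≤ η y)
    {ζ : EuclideanSpace ℝ (Fin N)} (hζ : ‖ζ‖ ≤ 1)
    {u : EuclideanSpace ℝ (Fin N) → ℝ} (hu : ContinuousOn u (closedBall 0 1))
    {δ : ℝ} (hδ : 0 < δ) :
    ∃ ε, 0 < ε ∧ ε ≤ 1 ∧ |(∫ x in ball 0 1, u x * ps η ζ ε x) - u ζ| ≤ δ := by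
  obtain ⟨r, hr, hr'⟩ := Metric.continuousOn_iff.1 hu ζ (by simpa using hζ) δ hδ
  refine ⟨min 1 (r/4), by positivity, min_le_left _ _, ?_⟩
  set t := min 1 (r/4) with htdef
  have ht : 0 < t := by positivity
  have ht1 : t ≤ 1 := min_le_left _ _
  have htr : t ≤ r/4 := min_le_right _ _
  have hpsc : Continuous (ps η ζ t) := (ps_contDiff hη ζ t).continuous
  have hps0 : ∀ x, 0 ≤ ps η ζ t x := fun x => mul_nonneg (by positivity) (h0 _)
  have hpi : IntegrableOn (ps η ζ t) (ball 0 1) := contOn_ball_int hpsc.continuousOn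
  have hui : IntegrableOn (fun x => u x * ps η ζ t x) (ball 0 1) :=
    contOn_ball_int (hu.mul hpsc.continuousOn)
  have e : (∫ x in ball 0 1, u x * ps η ζ t x) - u ζ
      = ∫ x in ball 0 1, (u x * ps η ζ t x - u ζ * ps η ζ t x) := by
    rw [integral_sub hui (hpi.const_mul _), integral_const_mul, ps_setIntegral h1 hs hζ ht ht1, mul_one]
  rw [e]
  rw [← Real.norm_eq_abs]
  refine (norm_integral_le_integral_norm _).trans ?_
  calc ∫ x in ball 0 1, ‖u x * ps η ζ t x - u ζ * ps η ζ t x‖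
      ≤ ∫ x in ball 0 1, δ * ps η ζ t x := by
        refine setIntegral_mono_on (hui.sub (hpi.const_mul _)).norm (hpi.const_mul _)
          measurableSet_ball (fun x hx => ?_)
        rw [← sub_mul, norm_mul, Real.norm_of_nonneg (hps0 x)]
        by_cases h : ps η ζ t x = 0
        · simp [h]
        have h2 := (ps_ne hs hζ ht h).2.1
        have h3 := hr' x (ball_subset_closedBall hx) (by rw [dist_eq_norm]; linarith)
        exact mul_le_mul_of_nonneg_right (le_of_lt h3) (hps0 x)
    _ = δ := by rw [integral_const_mul, ps_setIntegral h1 hs hζ ht ht1, mul_one]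

theorem point_bound {N : ℕ} {η : EuclideanSpace ℝ (Fin N) → ℝ} (hη : ContDiff ℝ (⊤ : ℕ∞) η)
    {M M' : ℝ} (hM : ∀ y, |η y| ≤ M) (hM' : ∀ y, ‖fderiv ℝ η y‖ ≤ M') (h1 : ∫ x, η x = 1)
    (hs : ∀ y, 1/2 < ‖y‖ → η y = 0) (h0 : ∀ y, 0 ≤ η y) {p : ℝ} (hp : 1 < p) (hpN : (N:ℝ) < p)
    {ζ : EuclideanSpace ℝ (Fin N)} (hζ : ‖ζ‖ ≤ 1)
    {u : EuclideanSpace ℝ (Fin N) → ℝ} (hu : ContinuousOn u (closedBall 0 1))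
    {g : EuclideanSpace ℝ (Fin N) → EuclideanSpace ℝ (Fin N)}
    (hw : IsWeakGradOn (ball 0 1) u g)
    (hg : IntegrableOn (fun x => ‖g x‖ ^ p) (ball 0 1)) :
    |(∫ x in ball 0 1, u x * η x) - u ζ| ≤
      N * (2 * ((∫ x in ball 0 1, ‖g x‖ ^ p) ^ (1/p) * M ^ (1/p))) / (1 - N/p) := by
  have hα : 0 < 1 - (N:ℝ)/p := by rw [sub_pos, div_lt_one (by linarith)]; exact hpN
  have hM0 : 0 ≤ M := (abs_nonneg _).trans (hM 0)
  set α := 1 - (N:ℝ)/p with hαd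
  set K := N * (2 * ((∫ x in ball 0 1, ‖g x‖ ^ p) ^ (1/p) * M ^ (1/p))) with hK
  have hK0 : 0 ≤ K := by
    have : 0 ≤ ∫ x in ball 0 1, ‖g x‖ ^ p := integral_nonneg fun x => by positivity
    positivity
  set f : ℝ → ℝ := fun s => ∫ x in ball 0 1, u x * ps η ζ s x with hf
  have hfd : ∀ t, 0 < t → HasDerivAt f (∫ x in ball 0 1, u x * dps η ζ t x) t := fun t ht =>
    f_deriv hη hM hM' hζ hu ht
  have hfb : ∀ t, 0 < t → t ≤ 1 → |∫ x in ball 0 1, u x * dps η ζ t x| ≤ K * t ^ (α - 1) := by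
    intro t ht ht1
    refine (deriv_bound hη hM h1 hs h0 hp hζ hu hw hg ht ht1).trans (le_of_eq ?_)
    rw [hK, hαd]; ring_nf
  have hGd : ∀ t, 0 < t → HasDerivAt (fun s => K / α * s ^ α) (K * t ^ (α - 1)) t := by
    intro t ht
    refine ((Real.hasDerivAt_rpow_const (Or.inl ht.ne')).const_mul (K/α)).congr_deriv ?_
    field_simp
  have hf1 : f 1 = ∫ x in ball 0 1, u x * η x := by simp [hf, ps]
  rw [← hf1]
  have hmain : ∀ ε, 0 < ε → ε ≤ 1 → |f 1 - f ε| ≤ K / α := by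
    intro ε hε hε1
    have hm : ∀ (h : ℝ → ℝ) (h' : ℝ → ℝ), (∀ t, 0 < t → HasDerivAt h (h' t) t) →
        (∀ t, 0 < t → t ≤ 1 → 0 ≤ h' t) → h ε ≤ h 1 := by
      intro h h' hd hpos
      have := monotoneOn_of_deriv_nonneg (convex_Icc ε 1) (f := h)
        (fun t ht => (hd t (lt_of_lt_of_le hε ht.1)).continuousAt.continuousWithinAt)
        (fun t ht => (hd t (lt_of_lt_of_le hε (interior_subset ht).1)).differentiableAt.differentiableWithinAt)
        (fun t ht => by
          have ht' := interior_subset ht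
          rw [(hd t (lt_of_lt_of_le hε ht'.1)).deriv]
          exact hpos t (lt_of_lt_of_le hε ht'.1) ht'.2)
      exact this ⟨le_rfl, hε1⟩ ⟨hε1, le_rfl⟩ hε1
    have a1 := hm _ _ (fun t ht => (hGd t ht).sub (hfd t ht))
      (fun t ht ht1 => by linarith [(abs_le.1 (hfb t ht ht1)).2])
    have a2 := hm _ _ (fun t ht => (hGd t ht).add (hfd t ht))
      (fun t ht ht1 => by linarith [(abs_le.1 (hfb t ht ht1)).1])
    simp only [Pi.sub_apply, Pi.add_apply, Real.one_rpow, mul_one] at a1 a2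
    have a3 : 0 ≤ K / α * ε ^ α := by positivity
    rw [abs_le]; constructor <;> linarith
  refine le_of_forall_pos_le_add fun δ hδ => ?_
  obtain ⟨ε, hε, hε1, hl⟩ := f_limit hη h1 hs h0 hζ hu hδ
  have := abs_sub_le (f 1) (f ε) (u ζ)
  linarith [hmain ε hε hε1, show |f ε - u ζ| ≤ δ from hl]

theorem muBall_pos {N : ℕ} (hN : 0 < N) {p : ℝ} (hpN : (N : ℝ) < p)
    {z : EuclideanSpace ℝ (Fin N)} (hz : ‖z‖ = 1) : 0 < muBall p z := by
  have hN1 : (1:ℝ) ≤ N := by exact_mod_cast hN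
  have hp : 1 < p := by linarith
  have hp0 : 0 < p := by linarith
  let b : ContDiffBump (0 : EuclideanSpace ℝ (Fin N)) := ⟨1/4, 1/2, by norm_num, by norm_num⟩
  set η : EuclideanSpace ℝ (Fin N) → ℝ := b.normed volume with hηd
  have hη : ContDiff ℝ (⊤ : ℕ∞) η := b.contDiff_normed
  have hcs : HasCompactSupport η := b.hasCompactSupport_normed
  have h1 : ∫ x, η x = 1 := b.integral_normed
  have h0 : ∀ y, 0 ≤ η y := b.nonneg_normed
  have hs : ∀ y, 1/2 < ‖y‖ → η y = 0 := by
    intro y hy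
    by_contra h
    have h2 : y ∈ Function.support (b.normed volume) := h
    rw [b.support_normed_eq] at h2
    have h3 : ‖y‖ < 1/2 := by simpa [b] using h2
    linarith
  obtain ⟨M, hM⟩ := hcs.exists_bound_of_continuous hη.continuous
  obtain ⟨M', hM'⟩ := (hcs.fderiv ℝ).exists_bound_of_continuous (hη.continuous_fderiv (by simp))
  have hMa : ∀ y, |η y| ≤ max M 1 := fun y => (hM y).trans (le_max_left _ _)
  have hα : 0 < 1 - (N:ℝ)/p := by rw [sub_pos, div_lt_one (by linarith)]; exact hpN
  set C := N * (2 * (max M 1) ^ (1/p)) / (1 - (N:ℝ)/p) with hC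
  have hC0 : 0 < C := by
    have : 0 < max M 1 := lt_of_lt_of_le one_pos (le_max_right _ _)
    positivity
  have hlow : (1 / (2 * C)) ^ p ≤ muBall p z := by
    rw [muBall_eq]
    refine le_csInf (muSet_nonempty hp0 hz) ?_
    rintro E ⟨u, g, hu, hw, -, hg, hu0, huz, rfl⟩
    have b1 := point_bound hη hMa hM' h1 hs h0 hp hpN (ζ := 0) (by simp) hu hw hg
    have b2 := point_bound hη hMa hM' h1 hs h0 hp hpN (ζ := z) hz.le hu hw hg
    set E := ∫ x in ball 0 1, ‖g x‖ ^ p with hE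
    have hE0 : 0 ≤ E := integral_nonneg fun x => by positivity
    have e : N * (2 * (E ^ (1/p) * (max M 1) ^ (1/p))) / (1 - (N:ℝ)/p) = C * E ^ (1/p) := by
      rw [hC]; ring
    rw [e] at b1 b2
    rw [hu0] at b1
    rw [huz] at b2
    have b3 : 1 ≤ 2 * C * E ^ (1/p) := by
      linarith [(abs_le.1 b1).1, (abs_le.1 b2).2]
    have b4 : 1 / (2 * C) ≤ E ^ (1/p) := by
      rw [div_le_iff₀ (by positivity)]; linarith
    calc (1 / (2 * C)) ^ p ≤ (E ^ (1/p)) ^ p := Real.rpow_le_rpow (by positivity) b4 hp0.le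
      _ = E := by rw [← Real.rpow_mul hE0, one_div_mul_cancel hp0.ne', Real.rpow_one]
  exact lt_of_lt_of_le (by positivity) hlow

theorem part_one {N : ℕ} (hN : 0 < N) {p : ℝ} (hp : (N : ℝ) < p)
    {z' : EuclideanSpace ℝ (Fin N)} (hz : ‖z'‖ = 1)
    {u : EuclideanSpace ℝ (Fin N) → ℝ} (hu : ContDiff ℝ (⊤ : ℕ∞) u) (hc : HasCompactSupport u)
    (x y : EuclideanSpace ℝ (Fin N)) :
        |u x - u y| ≤ (muBall p z') ^ (-(1/p)) *
          (∫ w : EuclideanSpace ℝ (Fin N), ‖gradient u w‖ ^ p) ^ (1/p) *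
          ‖x - y‖ ^ (1 - (N : ℝ)/p) := by
  have hp0 : 0 < p := lt_of_le_of_lt (Nat.cast_nonneg N) hp
  have hμ := muBall_pos hN hp hz
  have hI : 0 ≤ ∫ w, ‖gradient u w‖ ^ p := integral_nonneg fun w => by positivity
  have h : u x ≠ u y → _ := core hp0 hz hu hc (x := x) (y := y)
  generalize (∫ w, ‖gradient u w‖ ^ p) = I at *
  generalize muBall p z' = m at *
  by_cases hxy : u x = u y
  · rw [hxy, sub_self, abs_zero]; positivity
  replace h := h hxy
  have h2 : |u x - u y| ^ p ≤ m⁻¹ * I * ‖x - y‖ ^ (p - N) := by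
    rw [mul_assoc, le_inv_mul_iff₀ hμ]
    linarith
  have h3 := Real.rpow_le_rpow (by positivity) h2 (by positivity : 0 ≤ 1/p)
  rw [← Real.rpow_mul (abs_nonneg _), mul_one_div_cancel hp0.ne', Real.rpow_one,
    Real.mul_rpow (by positivity) (by positivity), Real.mul_rpow (by positivity) (by positivity),
    ← Real.rpow_mul (norm_nonneg _), Real.inv_rpow hμ.le, ← Real.rpow_neg hμ.le] at h3
  have e : (p - N) * (1/p) = 1 - (N:ℝ)/p := by field_simp
  rwa [e] at h3

theorem holder_le {N : ℕ} {α : ℝ} {u : EuclideanSpace ℝ (Fin N) → ℝ} {C : ℝ} (hC : 0 ≤ C)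
    (h : ∀ x y, |u x - u y| ≤ C * ‖x - y‖ ^ α) :
    holderSem α Set.univ u ≤ ENNReal.ofReal C := by
  unfold holderSem
  refine iSup₂_le fun x _ => iSup₂_le fun y _ => ENNReal.ofReal_le_ofReal ?_
  exact div_le_of_le_mul₀ (by positivity) hC (h x y)

theorem holder_smul {N : ℕ} {α : ℝ} {u : EuclideanSpace ℝ (Fin N) → ℝ} {c : ℝ} (hc : 0 ≤ c) :
    holderSem α Set.univ (fun x => c * u x) = ENNReal.ofReal c * holderSem α Set.univ u := by
  unfold holderSem
  simp only [ENNReal.mul_iSup]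
  refine iSup_congr fun x => iSup_congr fun _ => iSup_congr fun y => iSup_congr fun _ => ?_
  rw [← ENNReal.ofReal_mul hc, ← mul_sub, abs_mul, abs_of_nonneg hc, mul_div_assoc]

theorem exists_holder_one {N : ℕ} (hN : 0 < N) {p : ℝ} (hp : (N : ℝ) < p)
    {z' : EuclideanSpace ℝ (Fin N)} (hz : ‖z'‖ = 1) :
    ∃ u : EuclideanSpace ℝ (Fin N) → ℝ, ContDiff ℝ (⊤ : ℕ∞) u ∧
    HasCompactSupport u ∧ holderSem (1 - (N : ℝ)/p) Set.univ u = 1 := by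
  let b : ContDiffBump (0 : EuclideanSpace ℝ (Fin N)) := ⟨1/4, 1/2, by norm_num, by norm_num⟩
  have hb : ContDiff ℝ (⊤ : ℕ∞) b := b.contDiff
  have hbc : HasCompactSupport b := b.hasCompactSupport
  have hμ := muBall_pos hN hp hz
  set α := 1 - (N : ℝ)/p with hα
  have hfin : holderSem α Set.univ b ≠ ⊤ := by
    refine ne_top_of_le_ne_top ENNReal.ofReal_ne_top
      (holder_le ?_ (part_one hN hp hz hb hbc))
    have hI : 0 ≤ ∫ w, ‖gradient b w‖ ^ p := integral_nonneg fun w => by positivity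
    exact mul_nonneg (Real.rpow_nonneg hμ.le _) (Real.rpow_nonneg hI _)
  have hpos : holderSem α Set.univ b ≠ 0 := by
    have h1 : ENNReal.ofReal (|b 0 - b z'| / ‖0 - z'‖ ^ α) ≤ holderSem α Set.univ b := by
      unfold holderSem
      exact le_iSup₂_of_le 0 (mem_univ _) (le_iSup₂_of_le z' (mem_univ _) le_rfl)
    have h2 : b 0 = 1 := b.one_of_mem_closedBall (by simp [b])
    have h3 : b z' = 0 := b.zero_of_le_dist (by simp [b, hz]; norm_num)
    rw [h2, h3] at h1
    simp [hz] at h1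
    intro h
    rw [h] at h1
    simp at h1
  set S := (holderSem α Set.univ b).toReal with hS
  have hS0 : 0 < S := ENNReal.toReal_pos hpos hfin
  refine ⟨fun x => S⁻¹ * b x, contDiff_const.mul hb, hbc.mul_left, ?_⟩
  rw [holder_smul (by positivity), ← ENNReal.ofReal_toReal hfin, ← hS,
    ← ENNReal.ofReal_mul (by positivity), inv_mul_cancel₀ hS0.ne', ENNReal.ofReal_one]

/-- Morrey inequality with the constant `μ_p(B_1)`: for `p > N`, `α_p = 1 - N/p` and
`u ∈ C_0^∞(ℝ^N)`, `|u(x)-u(y)| ≤ μ_p(B_1)^{-1/p} ‖∇u‖_{L^p} |x-y|^{α_p}`; consequently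
the sharp Morrey constant satisfies `𝔪_p(ℝ^N) ≥ μ_p(B_1)`. -/
theorem morrey_inequality_and_lower_bound {N : ℕ} (hN : 0 < N) (p : ℝ) (hp : (N : ℝ) < p)
    (z' : EuclideanSpace ℝ (Fin N))
    (hz' : z' ∈ Metric.sphere (0 : EuclideanSpace ℝ (Fin N)) 1) :
    (∀ u : EuclideanSpace ℝ (Fin N) → ℝ, ContDiff ℝ (⊤ : ℕ∞) u → HasCompactSupport u →
      ∀ x y : EuclideanSpace ℝ (Fin N),
        |u x - u y| ≤ (muBall p z') ^ (-(1/p)) *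
          (∫ w : EuclideanSpace ℝ (Fin N), ‖gradient u w‖ ^ p) ^ (1/p) *
          ‖x - y‖ ^ (1 - (N : ℝ)/p)) ∧
    muBall p z' ≤ morreyConst N p := by
  have hz : ‖z'‖ = 1 := by simpa using hz'
  refine ⟨fun u hu hc x y => part_one hN hp hz hu hc x y, ?_⟩
  have hp0 : 0 < p := lt_of_le_of_lt (Nat.cast_nonneg N) hp
  have hμ := muBall_pos hN hp hz
  unfold morreyConst
  refine le_csInf ?_ ?_
  · obtain ⟨u, h1, h2, h3⟩ := exists_holder_one hN hp hz
    exact ⟨_, u, h1, h2, h3, rfl⟩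
  · rintro E ⟨u, hu, hc, h1, rfl⟩
    have hI : 0 ≤ ∫ w, ‖gradient u w‖ ^ p := integral_nonneg fun w => by positivity
    have h2 := holder_le (mul_nonneg (Real.rpow_nonneg hμ.le _) (Real.rpow_nonneg hI _)) (part_one hN hp hz hu hc)
    rw [h1, ENNReal.one_le_ofReal] at h2
    generalize (∫ w, ‖gradient u w‖ ^ p) = I at *
    generalize muBall p z' = m at *
    rw [Real.rpow_neg hμ.le, le_inv_mul_iff₀ (by positivity), mul_one] at h2
    exact (Real.rpow_le_rpow_iff hμ.le hI (by positivity)).1 h2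
end
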